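/- Let X and Y be complete metric spaces, let μ be a non-atomic Radon probability measure on X, let T be a metric space, and suppose the mapping t ↦ ν_t from T to P_r(Y) is continuous in the weak topology. Let h : X × Y × T → [0,∞) be a continuous function such that h(x,y,t) ≤ a_t(x) + b_t(y), where a_t ∈ L¹(μ), b_t ∈ L¹(ν_t) are nonnegative Borel functions with lim_{R→+∞} sup_{t∈T} ( ∫_{{a_t ≥ R}} a_t dμ + ∫_{{b_t ≥ R}} b_t dν_t ) = 0. Then for every ε > 0 one can select ε-optimal Monge mappings T_t^ε : X → Y for the cost functions h_t = h(·,·,t) and marginals (μ, ν_t), i.e. μ∘(T_t^ε)⁻¹ = ν_t for every t ∈ T and ∫ h_t(x, T_t^ε(x)) μ(dx) ≤ K_{h_t}(μ, ν_t) + ε, such that the family (T_t^ε) is continuous in t in the sense of convergence μ-a.e. -/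

import Mathlib

open MeasureTheory Filter Topology

noncomputable section

/-- `σ` is a coupling of `μ` and `ν`, i.e. an element of `Π(μ, ν)`: a measure on the
product whose projections onto the factors are `μ` and `ν`. -/
def IsCoupling {X Y : Type*} [MeasurableSpace X] [MeasurableSpace Y]
    (σ : Measure (X × Y)) (μ : Measure X) (ν : Measure Y) : Prop :=
  σ.map Prod.fst = μ ∧ σ.map Prod.snd = ν

/-- The Kantorovich optimal transportation cost
`K_h(μ, ν) = inf {∫ h dσ : σ ∈ Π(μ, ν)}` (for a nonnegative cost `h`). -/
def kantorovichCost {X Y : Type*} [MeasurableSpace X] [MeasurableSpace Y]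
    (h : X → Y → ℝ) (μ : Measure X) (ν : Measure Y) : ENNReal :=
  ⨅ (σ : Measure (X × Y)) (_ : IsCoupling σ μ ν), ∫⁻ p, ENNReal.ofReal (h p.1 p.2) ∂σ

/-- A family of measures `t ↦ μ t` is continuous in the weak topology generated by
integration against bounded continuous functions. -/
def WeaklyContinuousFamily {T X : Type*} [TopologicalSpace T] [TopologicalSpace X]
    [MeasurableSpace X] (μ : T → Measure X) : Prop :=
  ∀ f : BoundedContinuousFunction X ℝ, Continuous fun t => ∫ x, f x ∂(μ t)


namespace AMT

/-- Lebesgue measure on `[0,1)`. -/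
def lam : Measure ℝ := volume.restrict (Set.Ico 0 1)

instance : IsProbabilityMeasure lam := ⟨by simp [lam]⟩

/-- A consistent tree of weights. -/
structure WTree {I : Type*} (w : List I → ℝ) : Prop where
  nonneg : ∀ s, 0 ≤ w s
  root : w [] = 1
  sum : ∀ s, HasSum (fun i => w (i :: s)) (w s)

/-- Left end points. -/
def lo {I : Type*} (w : List I → ℝ) : List I → ℝ
  | [] => 0
  | i :: s => lo w s + ∑' j, Set.indicator {j | WellOrderingRel j i} (fun j => w (j :: s)) j

section tree
variable {I : Type*} {w : List I → ℝ}

def cell (w : List I → ℝ) (s : List I) : Set ℝ := Set.Ico (lo w s) (lo w s + w s)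
def ocell (w : List I → ℝ) (s : List I) : Set ℝ := Set.Ioo (lo w s) (lo w s + w s)

lemma ocell_sub (s : List I) : ocell w s ⊆ cell w s := Set.Ioo_subset_Ico_self

lemma summ_ite (hw : WTree w) (s : List I) (A : Set I) :
    Summable (A.indicator (fun j => w (j :: s))) :=
  (hw.sum s).summable.indicator A

lemma lo_le (hw : WTree w) (i : I) (s : List I) : lo w s ≤ lo w (i :: s) := by
  rw [lo]
  exact le_add_of_nonneg_right
    (tsum_nonneg fun j => Set.indicator_nonneg (fun _ _ => hw.nonneg _) j)

lemma lo_add_eq (hw : WTree w) (i : I) (s : List I) :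
    lo w (i :: s) + w (i :: s) =
      lo w s + ∑' j, Set.indicator {j | WellOrderingRel j i ∨ j = i} (fun j => w (j :: s)) j := by
  have h1 : ∑' j, Set.indicator {j | WellOrderingRel j i ∨ j = i} (fun j => w (j :: s)) j
      = (∑' j, Set.indicator {j | WellOrderingRel j i} (fun j => w (j :: s)) j) +
        ∑' j, Set.indicator {i} (fun j => w (j :: s)) j := by
    rw [← Summable.tsum_add (summ_ite hw s _) (summ_ite hw s _)]
    congr 1; ext j
    have h2 : {j | WellOrderingRel j i ∨ j = i} = {j | WellOrderingRel j i} ∪ {i} := by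
      ext; simp [or_comm]
    rw [h2, Set.indicator_union_of_disjoint]
    simp only [Set.disjoint_singleton_right]
    exact irrefl (r := WellOrderingRel) i
  have h2 : ∑' j, Set.indicator {i} (fun j => w (j :: s)) j = w (i :: s) := by
    rw [tsum_eq_single i]
    · simp
    · intro j hj; simp [hj]
  rw [h1, h2, ← add_assoc, lo]

lemma lo_add_le (hw : WTree w) (i : I) (s : List I) :
    lo w (i :: s) + w (i :: s) ≤ lo w s + w s := by
  rw [lo_add_eq hw, ← (hw.sum s).tsum_eq]
  refine add_le_add le_rfl (Summable.tsum_le_tsum (fun j => ?_) (summ_ite hw s _) (hw.sum s).summable)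
  exact Set.indicator_le_self' (fun _ _ => hw.nonneg _) j

lemma lo_add_le_of_rel (hw : WTree w) {i j : I} (h : WellOrderingRel i j) (s : List I) :
    lo w (i :: s) + w (i :: s) ≤ lo w (j :: s) := by
  rw [lo_add_eq hw, lo]
  refine add_le_add le_rfl (Summable.tsum_le_tsum (fun k => ?_) (summ_ite hw s _) (summ_ite hw s _))
  refine Set.indicator_le_indicator_of_subset ?_ (fun _ => hw.nonneg _) k
  rintro k (hk | hk)
  · exact trans_of WellOrderingRel hk h
  · rw [hk]; exact h

lemma cell_cons_sub (hw : WTree w) (i : I) (s : List I) : cell w (i :: s) ⊆ cell w s :=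
  Set.Ico_subset_Ico (lo_le hw i s) (lo_add_le hw i s)

lemma cell_nil (hw : WTree w) : cell w [] = Set.Ico 0 1 := by
  simp [cell, lo, hw.root]

lemma cell_sub (hw : WTree w) (s : List I) : cell w s ⊆ Set.Ico 0 1 := by
  induction s with
  | nil => rw [cell_nil hw]
  | cons i s ih => exact (cell_cons_sub hw i s).trans ih

lemma cell_inj_cons (hw : WTree w) {i j : I} {s : List I} {v : ℝ}
    (hi : v ∈ cell w (i :: s)) (hj : v ∈ cell w (j :: s)) : i = j := by
  rcases trichotomous_of WellOrderingRel i j with h | h | h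
  · have := lo_add_le_of_rel hw h s
    simp only [cell, Set.mem_Ico] at hi hj; linarith
  · exact h
  · have := lo_add_le_of_rel hw h s
    simp only [cell, Set.mem_Ico] at hi hj; linarith

lemma cell_inj (hw : WTree w) {s s' : List I} (hl : s.length = s'.length) {v : ℝ}
    (hs : v ∈ cell w s) (hs' : v ∈ cell w s') : s = s' := by
  induction s generalizing s' with
  | nil => cases s' with
    | nil => rfl
    | cons i s' => simp at hl
  | cons i s ih => cases s' with
    | nil => simp at hl
    | cons j s' =>
      have h1 : s = s' := ih (by simpa using hl) (cell_cons_sub hw _ _ hs) (cell_cons_sub hw _ _ hs')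
      subst h1
      rw [cell_inj_cons hw hs hs']

lemma pos_of_mem_cell {s : List I} {v : ℝ} (h : v ∈ cell w s) : 0 < w s := by
  simp only [cell, Set.mem_Ico] at h; linarith

lemma w_cons_le (hw : WTree w) (i : I) (s : List I) : w (i :: s) ≤ w s :=
  le_hasSum (hw.sum s) i fun j _ => hw.nonneg _

lemma countable_charged (hw : WTree w) (n : ℕ) : {s : List I | s.length = n ∧ 0 < w s}.Countable := by
  induction n with
  | zero =>
    refine (Set.countable_singleton []).mono ?_
    rintro s ⟨h, -⟩
    simpa using h
  | succ n ih =>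
    have : {s : List I | s.length = n + 1 ∧ 0 < w s} ⊆
        ⋃ s ∈ {s : List I | s.length = n ∧ 0 < w s},
          (fun i => i :: s) '' (Function.support fun i => w (i :: s)) := by
      rintro s ⟨h, hp⟩
      cases s with
      | nil => simp at h
      | cons i s =>
        simp only [Set.mem_iUnion]
        exact ⟨s, ⟨by simpa using h, hp.trans_le (w_cons_le hw i s)⟩, i, hp.ne', rfl⟩
    exact (ih.biUnion fun s _ => ((hw.sum s).summable.countable_support).image _).mono this

lemma null_step (hw : WTree w) (s : List I) :
    volume (cell w s \ ⋃ i, ocell w (i :: s)) = 0 := by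
  have hc := (hw.sum s).summable.countable_support
  set c := Function.support fun i => w (i :: s) with hcdef
  have hU : volume (⋃ i ∈ c, ocell w (i :: s)) = ENNReal.ofReal (w s) := by
    rw [measure_biUnion hc]
    · have : ∀ p : c, volume (ocell w ((p : I) :: s)) = ENNReal.ofReal (w ((p : I) :: s)) := by
        intro p; simp [ocell]
      simp_rw [this]
      have hs : HasSum (fun p : c => w ((p : I) :: s)) (w s) :=
        (hasSum_subtype_iff_of_support_subset subset_rfl).2 (hw.sum s)
      rw [← ENNReal.ofReal_tsum_of_nonneg (fun p => hw.nonneg _) hs.summable, hs.tsum_eq]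
    · intro i _ j _ hij
      refine Set.disjoint_left.2 fun v hv hv' => hij (cell_inj_cons hw (ocell_sub _ hv) (ocell_sub _ hv'))
    · intro i _; exact measurableSet_Ioo
  have hsub : (⋃ i ∈ c, ocell w (i :: s)) ⊆ cell w s :=
    Set.iUnion₂_subset fun i _ => (ocell_sub _).trans (cell_cons_sub hw i s)
  have hm : MeasurableSet (⋃ i ∈ c, ocell w (i :: s)) :=
    MeasurableSet.biUnion hc fun i _ => measurableSet_Ioo
  refine measure_mono_null (t := cell w s \ ⋃ i ∈ c, ocell w (i :: s)) ?_ ?_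
  · refine Set.sdiff_subset_sdiff_right ?_
    exact Set.iUnion₂_subset fun i _ => Set.subset_iUnion (fun i => ocell w (i :: s)) i
  · rw [measure_sdiff hsub hm.nullMeasurableSet (by rw [hU]; exact ENNReal.ofReal_ne_top), hU]
    simp [cell]

lemma ae_good (hw : WTree w) (n : ℕ) : ∀ᵐ v ∂lam, ∃ s : List I, s.length = n ∧ v ∈ ocell w s := by
  induction n with
  | zero =>
    have h1 : ∀ᵐ v ∂lam, v ∈ Set.Ico (0:ℝ) 1 := ae_restrict_mem measurableSet_Ico
    have h2 : ∀ᵐ v ∂lam, v ≠ 0 := by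
      refine ae_restrict_of_ae ?_
      exact (measure_singleton (0:ℝ) : volume {(0:ℝ)} = 0) |> fun h => by
        rw [ae_iff]; simpa using h
    filter_upwards [h1, h2] with v h1 h2
    refine ⟨[], rfl, ?_⟩
    simp only [ocell, lo, hw.root, Set.mem_Ioo, zero_add]
    exact ⟨lt_of_le_of_ne h1.1 h2.symm, h1.2⟩
  | succ n ih =>
    have hc := countable_charged hw n
    have h3 : ∀ᵐ v ∂lam, ∀ s ∈ {s : List I | s.length = n ∧ 0 < w s},
        v ∉ cell w s \ ⋃ i, ocell w (i :: s) := by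
      rw [ae_ball_iff hc]
      intro s _
      refine ae_restrict_of_ae ?_
      exact measure_eq_zero_iff_ae_notMem.1 (null_step hw s)
    filter_upwards [ih, h3] with v ⟨s, hl, hv⟩ h3
    have hv' := ocell_sub _ hv
    have := h3 s ⟨hl, pos_of_mem_cell hv'⟩
    have h4 : v ∈ ⋃ i, ocell w (i :: s) := by
      by_contra h; exact this ⟨hv', h⟩
    obtain ⟨i, hi⟩ := Set.mem_iUnion.1 h4
    exact ⟨i :: s, by simp [hl], hi⟩

open Classical in
/-- The head of the string of length `n+1` selected by `v`. -/
def sel [Inhabited I] (w : List I → ℝ) (n : ℕ) (v : ℝ) : I :=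
  if h : ∃ p : I × List I, p.2.length = n ∧ v ∈ cell w (p.1 :: p.2) then h.choose.1 else default

lemma sel_eq [Inhabited I] (hw : WTree w) {i : I} {s : List I} {v : ℝ}
    (h : v ∈ cell w (i :: s)) : sel w s.length v = i := by
  have hex : ∃ p : I × List I, p.2.length = s.length ∧ v ∈ cell w (p.1 :: p.2) := ⟨(i, s), rfl, h⟩
  rw [sel, dif_pos hex]
  have := cell_inj hw (by simp [hex.choose_spec.1]) hex.choose_spec.2 h
  exact (List.cons.inj this).1

lemma sel_measurable [Inhabited I] [MeasurableSpace I] (hw : WTree w) (n : ℕ) :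
    Measurable (sel w n) := by
  intro B _
  have hc := countable_charged hw (n + 1)
  set A := {s : List I | s.length = n + 1 ∧ 0 < w s} with hA
  have key : sel w n ⁻¹' B = (⋃ s ∈ {s ∈ A | ∃ i ∈ B, ∃ s', s = i :: s'}, cell w s) ∪
      ((⋃ s ∈ A, cell w s)ᶜ ∩ {_v : ℝ | (default : I) ∈ B}) := by
    ext v
    by_cases hex : ∃ p : I × List I, p.2.length = n ∧ v ∈ cell w (p.1 :: p.2)
    · obtain ⟨⟨i, s⟩, hl, hv⟩ := hex
      simp only at hl hv
      have h1 : sel w n v = i := by rw [← hl]; exact sel_eq hw hv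
      have h2 : v ∈ ⋃ s ∈ A, cell w s := Set.mem_biUnion (x := i :: s)
        ⟨by simp [hl], pos_of_mem_cell hv⟩ hv
      simp only [Set.mem_preimage, h1, Set.mem_union, Set.mem_inter_iff, Set.mem_compl_iff, h2,
        not_true, false_and, or_false, Set.mem_iUnion]
      constructor
      · intro hi
        exact ⟨i :: s, ⟨⟨by simp [hl], pos_of_mem_cell hv⟩, i, hi, s, rfl⟩, hv⟩
      · rintro ⟨s2, ⟨⟨hl2, -⟩, j, hj, s', rfl⟩, hv2⟩
        have := cell_inj hw (by simp [hl]; simpa using hl2.symm) hv hv2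
        rw [(List.cons.inj this).1]; exact hj
    · have h1 : sel w n v = default := by rw [sel, dif_neg hex]
      have h2 : v ∉ ⋃ s ∈ A, cell w s := by
        simp only [Set.mem_iUnion, not_exists]
        rintro s ⟨hl, -⟩ hv
        cases s with
        | nil => simp at hl
        | cons i s => exact hex ⟨(i, s), by simpa using hl, hv⟩
      have h3 : v ∉ ⋃ s ∈ {s ∈ A | ∃ i ∈ B, ∃ s', s = i :: s'}, cell w s := fun h => h2 (by
        simp only [Set.mem_iUnion] at h ⊢
        obtain ⟨s, hs, hv⟩ := h
        exact ⟨s, hs.1, hv⟩)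
      rw [Set.mem_preimage, h1, Set.mem_union, Set.mem_inter_iff]
      exact ⟨fun h => Or.inr ⟨h2, h⟩, fun h => h.elim (fun h => absurd h h3) fun h => h.2⟩
  rw [key]
  refine MeasurableSet.union (MeasurableSet.biUnion (hc.mono fun s hs => hs.1)
    fun s _ => measurableSet_Ico) (MeasurableSet.inter (MeasurableSet.biUnion hc
    fun s _ => measurableSet_Ico).compl (MeasurableSet.const _))

end tree

section contTree

lemma lsc_tsum {I T : Type*} [TopologicalSpace T] (c : I → T → ℝ) (h0 : ∀ i t, 0 ≤ c i t)
    (hc : ∀ i, Continuous (c i)) (hs : ∀ t, Summable fun i => c i t) (t : T) (a : ℝ)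
    (ha : a < ∑' i, c i t) : ∀ᶠ t' in 𝓝 t, a < ∑' i, c i t' := by
  obtain ⟨F, hF⟩ := ((hs t).hasSum.eventually (lt_mem_nhds ha)).exists
  have hcont : Continuous fun t' => ∑ i ∈ F, c i t' := continuous_finsetSum _ fun i _ => hc i
  filter_upwards [hcont.continuousAt.eventually (lt_mem_nhds hF)] with t' ht'
  exact ht'.trans_le ((hs t').sum_le_tsum F fun i _ => h0 i t')

lemma cont_tsum {I T : Type*} [TopologicalSpace T] (c : I → T → ℝ) (h0 : ∀ i t, 0 ≤ c i t)
    (hc : ∀ i, Continuous (c i)) (f : T → ℝ) (hf : Continuous f)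
    (hs : ∀ t, HasSum (fun i => c i t) (f t)) (A : Set I) :
    Continuous fun t => ∑' i, A.indicator (fun i => c i t) i := by
  have gen : ∀ A : Set I, (∀ i t, 0 ≤ A.indicator (fun i => c i t) i) ∧
      (∀ i, Continuous fun t => A.indicator (fun i => c i t) i) ∧
      (∀ t, Summable fun i => A.indicator (fun i => c i t) i) := by
    intro A
    refine ⟨fun i t => Set.indicator_nonneg (fun _ _ => h0 _ _) i, fun i => ?_, fun t =>
      (hs t).summable.indicator A⟩
    by_cases h : i ∈ A
    · simpa [h] using hc i
    · simpa [h] using continuous_const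
  have hsum : ∀ t, (∑' i, A.indicator (fun i => c i t) i) =
      f t - ∑' i, Aᶜ.indicator (fun i => c i t) i := by
    intro t
    rw [eq_sub_iff_add_eq, ← Summable.tsum_add ((gen A).2.2 t) ((gen Aᶜ).2.2 t),
      ← (hs t).tsum_eq]
    congr 1; ext i
    exact congrFun (Set.indicator_self_add_compl A (fun i => c i t)) i
  rw [continuous_iff_continuousAt]
  intro t
  rw [ContinuousAt, tendsto_order]
  refine ⟨fun a ha => lsc_tsum (fun i t => A.indicator (fun i => c i t) i)
    (gen A).1 (gen A).2.1 (gen A).2.2 t a ha, fun a ha => ?_⟩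
  rw [hsum] at ha
  set b := ∑' i, Aᶜ.indicator (fun i => c i t) i with hb
  obtain ⟨δ, hδ, hδ'⟩ : ∃ δ > 0, f t - b + 2 * δ < a := ⟨(a - (f t - b)) / 4, by linarith, by linarith⟩
  have e1 := lsc_tsum (fun i t => Aᶜ.indicator (fun i => c i t) i) (gen _).1 (gen _).2.1
    (gen _).2.2 t (b - δ) (by linarith)
  have e2 := hf.continuousAt.eventually (gt_mem_nhds (show f t < f t + δ by linarith))
  filter_upwards [e1, e2] with t' e1 e2
  rw [hsum]
  linarith

lemma cont_lo {I T : Type*} [TopologicalSpace T] (w : T → List I → ℝ) (hw : ∀ t, WTree (w t))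
    (hc : ∀ s, Continuous fun t => w t s) (s : List I) : Continuous fun t => lo (w t) s := by
  induction s with
  | nil => exact continuous_const
  | cons i s ih =>
    simp only [lo]
    exact ih.add (cont_tsum (fun j t => w t (j :: s)) (fun j t => (hw t).nonneg _)
      (fun j => hc _) (fun t => w t s) (hc s) (fun t => (hw t).sum s) _)

lemma ocell_open {I T : Type*} [TopologicalSpace T] (w : T → List I → ℝ) (hw : ∀ t, WTree (w t))
    (hc : ∀ s, Continuous fun t => w t s) (s : List I) {ι : Type*} {l : Filter ι} {t : T} {v : ℝ}
    {tn : ι → T} {vn : ι → ℝ} (ht : Tendsto tn l (𝓝 t)) (hv : Tendsto vn l (𝓝 v))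
    (h : v ∈ ocell (w t) s) : ∀ᶠ n in l, vn n ∈ ocell (w (tn n)) s := by
  have h1 := ((cont_lo w hw hc s).tendsto t).comp ht
  have h2 := (((cont_lo w hw hc s).add (hc s)).tendsto t).comp ht
  exact (h1.eventually_lt hv h.1).and (hv.eventually_lt h2 h.2)

end contTree

end AMT
namespace AMT

lemma exists_sep {Z : Type*} [MetricSpace Z] [MeasurableSpace Z] [BorelSpace Z] (m : Measure Z)
    [IsProbabilityMeasure m] (hm : m.InnerRegular) :
    ∃ D : Set Z, D.Countable ∧ ∀ᵐ z ∂m, z ∈ closure D := by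
  have h1 : ∀ n : ℕ, ∃ K : Set Z, IsCompact K ∧ 1 - ((n : ENNReal) + 1)⁻¹ < m K := by
    intro n
    obtain ⟨K, -, hK, h⟩ := MeasurableSet.univ.exists_lt_isCompact (μ := m)
      (r := 1 - ((n : ENNReal) + 1)⁻¹) (by
        rw [measure_univ]
        refine ENNReal.sub_lt_self (by simp) (by simp) ?_
        simp)
    exact ⟨K, hK, h⟩
  choose K hK hKm using h1
  obtain ⟨D, hD, hKD⟩ := TopologicalSpace.IsSeparable.iUnion fun n => (hK n).isSeparable
  refine ⟨D, hD, ?_⟩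
  have hc : m (closure D) = 1 := by
    refine le_antisymm prob_le_one ?_
    have : Tendsto (fun n : ℕ => 1 - ((n : ENNReal) + 1)⁻¹) atTop (𝓝 (1 - 0)) := by
      refine ENNReal.Tendsto.sub tendsto_const_nhds ?_ (by simp)
      have := ENNReal.tendsto_inv_nat_nhds_zero.comp (tendsto_add_atTop_nat 1)
      refine this.congr fun n => ?_
      simp
    rw [tsub_zero] at this
    refine le_of_tendsto' this fun n => (hKm n).le.trans (measure_mono ?_)
    exact (Set.subset_iUnion K n).trans hKD
  exact (prob_compl_eq_zero_iff isClosed_closure.measurableSet).2 hc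

section skor
variable {Y : Type*} [MetricSpace Y]

/-- Products of partition functions along a string. -/
def W (ψ : ℕ → PartitionOfUnity Y Y Set.univ) : List Y → Y → ℝ
  | [], _ => 1
  | i :: s, y => W ψ s y * ψ s.length i y

variable (ψ : ℕ → PartitionOfUnity Y Y Set.univ)

lemma W_cont (s : List Y) : Continuous (W ψ s) := by
  induction s with
  | nil => exact continuous_const
  | cons i s ih => exact ih.mul (ψ s.length i).continuous

lemma W_nonneg (s : List Y) (y : Y) : 0 ≤ W ψ s y := by
  induction s with
  | nil => exact zero_le_one
  | cons i s ih => exact mul_nonneg ih ((ψ s.length).nonneg i y)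

lemma W_le_one (s : List Y) (y : Y) : W ψ s y ≤ 1 := by
  induction s with
  | nil => exact le_rfl
  | cons i s ih => exact mul_le_one₀ ih ((ψ s.length).nonneg i y) ((ψ s.length).le_one i y)

lemma W_hasSum (s : List Y) (y : Y) : HasSum (fun i => W ψ (i :: s) y) (W ψ s y) := by
  have h := (ψ s.length).sum_eq_one (Set.mem_univ y)
  have hf : (Function.support fun i => ψ s.length i y).Finite :=
    (ψ s.length).locallyFinite.point_finite y
  have h2 : HasSum (fun i => ψ s.length i y) 1 := by
    have hsm : Summable (fun i => ψ s.length i y) := summable_of_finite_support hf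
    have h3 := hsm.hasSum
    rwa [tsum_eq_finsum hf, h] at h3
  simpa [W] using h2.mul_left (W ψ s y)

variable [MeasurableSpace Y] [BorelSpace Y]

lemma lint_step (m : Measure Y) [IsProbabilityMeasure m] (hm : m.InnerRegular)
    (s : List Y) (F : Set Y) :
    ∑' i, ∫⁻ y in F, ENNReal.ofReal (W ψ (i :: s) y) ∂m =
      ∫⁻ y in F, ENNReal.ofReal (W ψ s y) ∂m := by
  obtain ⟨D, hD, hDm⟩ := exists_sep m hm
  set c : Set Y := ⋃ y ∈ D, Function.support fun i => ψ s.length i y with hc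
  have hcc : c.Countable := hD.biUnion fun y _ =>
    ((ψ s.length).locallyFinite.point_finite y).countable
  have hz : ∀ i ∉ c, ∀ y ∈ closure D, ψ s.length i y = 0 := by
    intro i hi y hy
    have : closure D ⊆ {y | ψ s.length i y = 0} := by
      refine closure_minimal ?_ (isClosed_eq (ψ s.length i).continuous continuous_const)
      intro y hy
      by_contra h
      exact hi (Set.mem_biUnion hy h)
    exact this hy
  have hDr : ∀ᵐ y ∂(m.restrict F), y ∈ closure D := ae_restrict_of_ae hDm
  have h0 : ∀ i ∉ c, ∫⁻ y in F, ENNReal.ofReal (W ψ (i :: s) y) ∂m = 0 := by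
    intro i hi
    rw [lintegral_eq_zero_iff ((W_cont ψ _).measurable.ennreal_ofReal)]
    filter_upwards [hDr] with y hy
    simp [W, hz i hi y hy]
  haveI := hcc.to_subtype
  rw [← tsum_subtype_eq_of_support_subset (s := c) (by
    intro i hi; by_contra h; exact hi (h0 i h))]
  rw [← lintegral_tsum fun i : c => ((W_cont ψ _).measurable.ennreal_ofReal).aemeasurable]
  refine lintegral_congr_ae ?_
  filter_upwards [hDr] with y hy
  have hs : HasSum (fun i : c => W ψ ((i : Y) :: s) y) (W ψ s y) :=
    (hasSum_subtype_iff_of_support_subset (by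
      intro i hi; by_contra h; exact hi (by simp [W, hz i h y hy]))).2 (W_hasSum ψ s y)
  rw [← ENNReal.ofReal_tsum_of_nonneg (fun i => W_nonneg ψ _ y) hs.summable, hs.tsum_eq]

/-- The weights. -/
def wt (m : Measure Y) (s : List Y) : ℝ := ∫ y, W ψ s y ∂m

lemma wt_ofReal (m : Measure Y) [IsProbabilityMeasure m] (s : List Y) :
    ENNReal.ofReal (wt ψ m s) = ∫⁻ y, ENNReal.ofReal (W ψ s y) ∂m := by
  refine ofReal_integral_eq_lintegral_ofReal ?_ (Eventually.of_forall fun y => W_nonneg ψ s y)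
  refine Integrable.of_bound (W_cont ψ s).measurable.aestronglyMeasurable 1
    (Eventually.of_forall fun y => ?_)
  rw [Real.norm_of_nonneg (W_nonneg ψ s y)]
  exact W_le_one ψ s y

lemma wt_tree (m : Measure Y) [IsProbabilityMeasure m] (hm : m.InnerRegular) :
    WTree (wt ψ m) where
  nonneg s := integral_nonneg fun y => W_nonneg ψ s y
  root := by simp [wt, W]
  sum s := by
    have h0 : ∀ s, 0 ≤ wt ψ m s := fun s => integral_nonneg fun y => W_nonneg ψ s y
    have h := lint_step ψ m hm s Set.univ
    simp only [Measure.restrict_univ, ← wt_ofReal] at h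
    have h1 : ∑' i, ENNReal.ofReal (wt ψ m (i :: s)) ≠ ⊤ := by rw [h]; exact ENNReal.ofReal_ne_top
    have h2 := ENNReal.hasSum_toReal h1
    rw [← ENNReal.tsum_toReal_eq (fun i => ENNReal.ofReal_ne_top), h] at h2
    simpa [ENNReal.toReal_ofReal, h0] using h2

lemma ofReal_le_of_closed {m₁ m₂ : Measure Y} [IsProbabilityMeasure m₁] [IsProbabilityMeasure m₂]
    (h : ∀ F, IsClosed F → m₁ F ≤ m₂ F) : m₁ = m₂ := by
  have hop : ∀ U, IsOpen U → m₂ U ≤ m₁ U := by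
    intro U hU
    have := h Uᶜ hU.isClosed_compl
    rw [prob_compl_eq_one_sub hU.measurableSet, prob_compl_eq_one_sub hU.measurableSet] at this
    exact (ENNReal.sub_le_sub_iff_left prob_le_one (by simp)).1 this
  have hcl : ∀ F, IsClosed F → m₁ F = m₂ F := by
    intro F hF
    refine le_antisymm (h F hF) ?_
    have h1 := tendsto_measure_thickening_of_isClosed (μ := m₁) ⟨1, one_pos, measure_ne_top _ _⟩ hF
    refine ge_of_tendsto h1 ?_
    filter_upwards [self_mem_nhdsWithin] with r hr
    exact (measure_mono (Metric.self_subset_thickening hr F)).trans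
      (hop _ Metric.isOpen_thickening)
  refine ext_of_generate_finite {F | IsClosed F} ?_ isPiSystem_isClosed (fun F hF => hcl F hF) (by simp)
  rw [BorelSpace.measurable_eq (α := Y), borel_eq_generateFrom_isClosed]

variable (hψ : ∀ n, (ψ n).IsSubordinate fun y => Metric.ball y ((1 / 2 : ℝ) ^ n))

include hψ in
lemma dist_lt_of_W {i : Y} {s : List Y} {y : Y} (h : W ψ (i :: s) y ≠ 0) :
    dist y i < (1 / 2 : ℝ) ^ s.length := by
  have : ψ s.length i y ≠ 0 := fun h' => h (by simp [W, h'])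
  exact hψ s.length i (subset_tsupport _ this)

include hψ in
lemma dist_sel {m : Measure Y} {i j : Y} {s : List Y} (h : 0 < wt ψ m (j :: i :: s)) :
    dist i j ≤ 4 / 2 / 2 ^ s.length := by
  have : ∃ y, W ψ (j :: i :: s) y ≠ 0 := by
    by_contra! hc
    simp [wt, hc] at h
  obtain ⟨y, hy⟩ := this
  have h1 := dist_lt_of_W ψ hψ hy
  have h2 : W ψ (i :: s) y ≠ 0 := fun h' => hy (by rw [W, h', zero_mul])
  have h3 := dist_lt_of_W ψ hψ h2
  have h4 := dist_triangle_left i j y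
  simp only [List.length_cons, pow_succ] at h1
  have h5 : (0:ℝ) < (1/2)^s.length := by positivity
  have h6 : (4:ℝ) / 2 / 2 ^ s.length = 2 * (1/2)^s.length := by
    rw [one_div, inv_pow]; ring
  rw [h6]; linarith

include hψ in
lemma exists_S [CompleteSpace Y] [Inhabited Y] (m : Measure Y) [IsProbabilityMeasure m]
    (hm : m.InnerRegular) :
    ∃ S : ℝ → Y, Measurable S ∧ (∀ᵐ v ∂lam, ∀ n, dist (sel (wt ψ m) n v) (S v) ≤ 4 / 2 ^ n) := by
  have hw := wt_tree ψ m hm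
  have hd : ∀ᵐ v ∂lam, ∀ n, dist (sel (wt ψ m) n v) (sel (wt ψ m) (n + 1) v) ≤ 4 / 2 / 2 ^ n := by
    rw [ae_all_iff]
    intro n
    filter_upwards [ae_good hw (n + 2)] with v ⟨s, hl, hv⟩
    match s, hl, hv with
    | j :: i :: s, hl, hv =>
      have hl' : s.length = n := by simpa using hl
      have h1 : sel (wt ψ m) (n + 1) v = j := by
        have := sel_eq hw (ocell_sub _ hv)
        rwa [List.length_cons, hl'] at this
      have h2 : sel (wt ψ m) n v = i := by
        have := sel_eq hw (cell_cons_sub hw _ _ (ocell_sub _ hv))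
        rwa [hl'] at this
      rw [h1, h2, ← hl']
      exact dist_sel ψ hψ (pos_of_mem_cell (ocell_sub _ hv))
  obtain ⟨S, hS, hlim⟩ := measurable_limit_of_tendsto_metrizable_ae (μ := lam) (L := atTop)
    (f := fun n => sel (wt ψ m) n) (fun n => (sel_measurable hw n).aemeasurable) (by
      filter_upwards [hd] with v hv
      exact cauchySeq_tendsto_of_complete (cauchySeq_of_le_geometric_two hv))
  refine ⟨S, hS, ?_⟩
  filter_upwards [hd, hlim] with v hv hv' n
  exact dist_le_of_le_geometric_two_of_tendsto hv hv' n

include hψ in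
lemma map_S [Inhabited Y] (m : Measure Y) [IsProbabilityMeasure m]
    (hm : m.InnerRegular) (S : ℝ → Y) (hS : Measurable S)
    (hd : ∀ᵐ v ∂lam, ∀ n, dist (sel (wt ψ m) n v) (S v) ≤ 4 / 2 ^ n) : lam.map S = m := by
  have hw := wt_tree ψ m hm
  haveI : IsProbabilityMeasure (lam.map S) := Measure.isProbabilityMeasure_map hS.aemeasurable
  refine ofReal_le_of_closed fun F hF => ?_
  set G : ℕ → Set Y := fun n => Metric.cthickening (5 / 2 ^ n) F with hG
  rw [Measure.map_apply hS hF.measurableSet]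
  have step : ∀ s : List Y, (∑' i, lam (cell (wt ψ m) (i :: s) ∩ S ⁻¹' F)) ≥
      lam (cell (wt ψ m) s ∩ S ⁻¹' F) := by
    intro s
    have hc := (hw.sum s).summable.countable_support
    set c := Function.support fun i => wt ψ m (i :: s) with hcdef
    have h1 : lam (cell (wt ψ m) s ∩ S ⁻¹' F) ≤ lam (⋃ i ∈ c, cell (wt ψ m) (i :: s) ∩ S ⁻¹' F) := by
      refine measure_mono_ae ?_
      have h2 : ∀ᵐ v ∂lam, v ∉ cell (wt ψ m) s \ ⋃ i, ocell (wt ψ m) (i :: s) :=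
        ae_restrict_of_ae (measure_eq_zero_iff_ae_notMem.1 (null_step hw s))
      filter_upwards [h2] with v h2
      rintro ⟨hv, hvF⟩
      have h4 : v ∈ ⋃ i, ocell (wt ψ m) (i :: s) := by
        by_contra h; exact h2 ⟨hv, h⟩
      obtain ⟨i, hi⟩ := Set.mem_iUnion.1 h4
      exact Set.mem_biUnion (x := i) (pos_of_mem_cell (ocell_sub _ hi)).ne' ⟨ocell_sub _ hi, hvF⟩
    refine h1.trans ((measure_biUnion_le _ hc _).trans ?_)
    exact ENNReal.tsum_comp_le_tsum_of_injective Subtype.val_injective _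
  have claim : ∀ n : ℕ, ∀ (i : Y) (s : List Y), lam (cell (wt ψ m) (i :: s) ∩ S ⁻¹' F) ≤
      ∫⁻ y in G (s.length + n), ENNReal.ofReal (W ψ (i :: s) y) ∂m := by
    intro n
    induction n with
    | zero =>
      intro i s
      by_cases hz : lam (cell (wt ψ m) (i :: s) ∩ S ⁻¹' F) = 0
      · rw [hz]; exact zero_le
      · have : ∃ v, v ∈ cell (wt ψ m) (i :: s) ∩ S ⁻¹' F ∧
            ∀ n, dist (sel (wt ψ m) n v) (S v) ≤ 4 / 2 ^ n := by
          by_contra! hcon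
          refine hz ?_
          rw [measure_eq_zero_iff_ae_notMem]
          filter_upwards [hd] with v hv hv'
          obtain ⟨n, hn⟩ := hcon v hv'
          exact absurd (hv n) (not_le.2 hn)
        obtain ⟨v, ⟨hv, hvF⟩, hvd⟩ := this
        have h1 := hvd s.length
        rw [sel_eq hw hv] at h1
        have h2 : ∀ y, y ∉ G s.length → W ψ (i :: s) y = 0 := by
          intro y hy
          by_contra hne
          refine hy ?_
          have h3 := dist_lt_of_W ψ hψ hne
          refine Metric.mem_cthickening_of_dist_le y (S v) _ F hvF ?_
          have h4 := dist_triangle y i (S v)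
          have h5 : (5:ℝ) / 2 ^ s.length = (1/2)^s.length + 4 / 2 ^ s.length := by
            rw [one_div, inv_pow]; ring
          rw [h5]; linarith
        have h3 : ∫⁻ y in G s.length, ENNReal.ofReal (W ψ (i :: s) y) ∂m =
            ENNReal.ofReal (wt ψ m (i :: s)) := by
          rw [wt_ofReal, setLIntegral_eq_of_support_subset]
          intro y hy
          by_contra hn
          exact hy (by simp [h2 y hn])
        rw [add_zero, h3]
        refine (measure_mono Set.inter_subset_left).trans ?_
        refine (Measure.restrict_apply_le _ _).trans ?_
        simp [cell]
    | succ n ih =>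
      intro i s
      refine (step (i :: s)).trans ?_
      rw [← lint_step ψ m hm]
      refine ENNReal.tsum_le_tsum fun j => ?_
      refine (ih j (i :: s)).trans (le_of_eq ?_)
      simp only [List.length_cons]
      rw [show s.length + 1 + n = s.length + (n + 1) by ring]
  have hn : ∀ n, lam (S ⁻¹' F) ≤ m (G n) := by
    intro n
    have h1 : lam (S ⁻¹' F) ≤ lam (cell (wt ψ m) [] ∩ S ⁻¹' F) := by
      refine measure_mono_ae ?_
      have h2 : ∀ᵐ v ∂lam, v ∈ Set.Ico (0:ℝ) 1 := ae_restrict_mem measurableSet_Ico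
      filter_upwards [h2] with v h2 h3
      exact ⟨by rw [cell_nil hw]; exact h2, h3⟩
    refine h1.trans ((step []).trans ?_)
    calc ∑' i, lam (cell (wt ψ m) [i] ∩ S ⁻¹' F)
        ≤ ∑' i, ∫⁻ y in G n, ENNReal.ofReal (W ψ [i] y) ∂m :=
          ENNReal.tsum_le_tsum fun i => by simpa using claim n i []
      _ = m (G n) := by rw [lint_step ψ m hm]; simp [W]
  have hlim := tendsto_measure_cthickening_of_isClosed (μ := m) ⟨1, one_pos, measure_ne_top _ _⟩ hF
  have h0 : Tendsto (fun n : ℕ => (5:ℝ) / 2 ^ n) atTop (𝓝 0) := by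
    have := (tendsto_pow_atTop_nhds_zero_of_lt_one (r := (1/2:ℝ)) (by norm_num) (by norm_num)).const_mul 5
    rw [mul_zero] at this
    refine this.congr fun n => ?_
    rw [one_div, inv_pow]; ring
  exact ge_of_tendsto' (hlim.comp h0) hn

end skor

theorem skorokhod {Y T : Type*} [MetricSpace Y] [CompleteSpace Y] [MeasurableSpace Y] [BorelSpace Y]
    [Nonempty Y] [TopologicalSpace T] (ν : T → Measure Y) (hνp : ∀ t, IsProbabilityMeasure (ν t))
    (hνr : ∀ t, (ν t).InnerRegular)
    (hνc : ∀ f : BoundedContinuousFunction Y ℝ, Continuous fun t => ∫ x, f x ∂(ν t)) :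
    ∃ S : T → ℝ → Y, (∀ t, Measurable (S t)) ∧ (∀ t, lam.map (S t) = ν t) ∧
      ∀ (t : T) (tn : ℕ → T), Tendsto tn atTop (𝓝 t) →
        ∀ᵐ v ∂lam, Tendsto (fun n => S (tn n) v) atTop (𝓝 (S t v)) := by
  classical
  inhabit Y
  have hex : ∀ n : ℕ, ∃ ψ : PartitionOfUnity Y Y Set.univ,
      ψ.IsSubordinate fun y => Metric.ball y ((1 / 2 : ℝ) ^ n) := fun n =>
    PartitionOfUnity.exists_isSubordinate isClosed_univ _ (fun _ => Metric.isOpen_ball)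
      (fun y _ => Set.mem_iUnion.2 ⟨y, Metric.mem_ball_self (by positivity)⟩)
  choose ψ hψ using hex
  have h1 : ∀ t, ∃ S : ℝ → Y, Measurable S ∧
      (∀ᵐ v ∂lam, ∀ n, dist (sel (wt ψ (ν t)) n v) (S v) ≤ 4 / 2 ^ n) := fun t =>
    exists_S ψ hψ (ν t) (hνr t)
  choose S hS hd using h1
  refine ⟨S, hS, fun t => map_S ψ hψ (ν t) (hνr t) (S t) (hS t) (hd t), fun t tn ht => ?_⟩
  have hw : ∀ t, WTree (wt ψ (ν t)) := fun t => wt_tree ψ (ν t) (hνr t)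
  have hc : ∀ s, Continuous fun t => wt ψ (ν t) s := fun s =>
    hνc (BoundedContinuousFunction.ofNormedAddCommGroup (W ψ s) (W_cont ψ s) 1 (fun y => by
      rw [Real.norm_of_nonneg (W_nonneg ψ s y)]; exact W_le_one ψ s y))
  have hg : ∀ᵐ v ∂lam, ∀ n, ∃ s : List Y, s.length = n ∧ v ∈ ocell (wt ψ (ν t)) s :=
    ae_all_iff.2 fun n => ae_good (hw t) n
  filter_upwards [hg, hd t, ae_all_iff.2 fun k => hd (tn k)] with v hg hdt hdn
  rw [Metric.tendsto_atTop']
  intro ε hε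
  have h0 : Tendsto (fun n : ℕ => (8:ℝ) / 2 ^ n) atTop (𝓝 0) := by
    have := (tendsto_pow_atTop_nhds_zero_of_lt_one (r := (1/2:ℝ)) (by norm_num) (by norm_num)).const_mul 8
    rw [mul_zero] at this
    refine this.congr fun n => ?_
    rw [one_div, inv_pow]; ring
  obtain ⟨n, hn⟩ := (h0.eventually (gt_mem_nhds hε)).exists
  obtain ⟨s, hl, hv⟩ := hg (n + 1)
  cases s with
  | nil => simp at hl
  | cons i s =>
    have hl' : s.length = n := by simpa using hl
    have hev := ocell_open _ hw hc (i :: s) ht (tendsto_const_nhds (x := v)) hv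
    obtain ⟨N, hN⟩ := eventually_atTop.1 hev
    refine ⟨N, fun k hk => ?_⟩
    have e1 := sel_eq (hw t) (ocell_sub _ hv)
    have e2 := sel_eq (hw (tn k)) (ocell_sub _ (hN k hk.le))
    rw [hl'] at e1 e2
    have d1 := hdt n
    have d2 := hdn k n
    rw [e1] at d1; rw [e2] at d2
    have h3 := dist_triangle_left (S (tn k) v) (S t v) i
    have h4 : (8:ℝ) / 2 ^ n = 4 / 2 ^ n + 4 / 2 ^ n := by ring
    linarith

end AMT
namespace AMT

lemma lam_Iic {x : ℝ} (h0 : 0 ≤ x) (h1 : x ≤ 1) : lam (Set.Iic x) = ENNReal.ofReal x := by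
  have e : lam = volume.restrict (Set.Icc 0 1) := Measure.restrict_congr_set Ico_ae_eq_Icc
  rw [e, Measure.restrict_apply measurableSet_Iic]
  have : Set.Iic x ∩ Set.Icc 0 1 = Set.Icc 0 x := by
    ext y; simp only [Set.mem_inter_iff, Set.mem_Iic, Set.mem_Icc]
    constructor
    · rintro ⟨a, b, c⟩; exact ⟨b, a⟩
    · rintro ⟨b, a⟩; exact ⟨a, b, a.trans h1⟩
  rw [this, Real.volume_Icc, sub_zero]

lemma map_cdf (m : Measure ℝ) [IsProbabilityMeasure m] [NullSingletonClass m] :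
    m.map (ProbabilityTheory.cdf m) = lam := by
  set F := ProbabilityTheory.cdf m with hF
  have hmono : Monotone F := F.mono
  have hFm : Measurable F := hmono.measurable
  have hcont : Continuous F := by
    rw [continuous_iff_continuousAt]
    intro x
    rw [hmono.continuousAt_iff_leftLim_eq_rightLim]
    have h1 : F.measure {x} = 0 := by rw [hF, ProbabilityTheory.measure_cdf]; simp
    rw [StieltjesFunction.measure_singleton, ENNReal.ofReal_eq_zero] at h1
    have h2 : Function.leftLim F x ≤ F x := hmono.leftLim_le le_rfl
    rw [F.rightLim_eq]; linarith
  have h01 : ∀ x, F x = (m (Set.Iic x)).toReal := fun x => by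
    rw [hF, ProbabilityTheory.cdf_eq_real]; rfl
  haveI : IsProbabilityMeasure (m.map F) := Measure.isProbabilityMeasure_map hFm.aemeasurable
  have key : ∀ a : ℝ, 0 < a → a < 1 → m (F ⁻¹' Set.Iio a) ≤ ENNReal.ofReal a ∧
      ENNReal.ofReal a ≤ m (F ⁻¹' Set.Iic a) := by
    intro a h0 h1
    obtain ⟨c, hc⟩ : ∃ c, F c = a := by
      have ht := ProbabilityTheory.tendsto_cdf_atTop m
      have hb := ProbabilityTheory.tendsto_cdf_atBot m
      obtain ⟨p, hp⟩ := (ht.eventually (lt_mem_nhds h1)).exists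
      obtain ⟨q, hq⟩ := (hb.eventually (gt_mem_nhds h0)).exists
      exact mem_range_of_exists_le_of_exists_ge hcont ⟨q, hq.le⟩ ⟨p, hp.le⟩
    have hmc : m (Set.Iic c) = ENNReal.ofReal a := by
      rw [← hc, h01, ENNReal.ofReal_toReal (measure_ne_top _ _)]
    rw [← hmc]
    refine ⟨measure_mono fun x hx => ?_, measure_mono fun x hx => ?_⟩
    · by_contra hcx
      have : F c ≤ F x := hmono (not_le.1 hcx).le
      rw [hc] at this; exact absurd hx (not_lt.2 this)
    · show F x ≤ a
      rw [← hc]; exact hmono hx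
  have hle1 : ∀ x, F x ≤ 1 := fun x => ProbabilityTheory.cdf_le_one m x
  have hge0 : ∀ x, 0 ≤ F x := fun x => ProbabilityTheory.cdf_nonneg m x
  have key2 : ∀ a : ℝ, 0 ≤ a → a < 1 → m (F ⁻¹' Set.Iic a) ≤ ENNReal.ofReal a := by
    intro a h0 h1
    have : Tendsto (fun b => ENNReal.ofReal b) (𝓝[>] a) (𝓝 (ENNReal.ofReal a)) :=
      (ENNReal.continuous_ofReal.tendsto a).mono_left nhdsWithin_le_nhds
    refine ge_of_tendsto this ?_
    filter_upwards [Ioo_mem_nhdsGT h1] with b hb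
    exact (measure_mono (fun x (hx : F x ≤ a) => (lt_of_le_of_lt hx hb.1 : F x < b))).trans
      (key b (h0.trans_lt hb.1) hb.2).1
  refine Measure.ext_of_Iic _ _ fun a => ?_
  rw [Measure.map_apply hFm measurableSet_Iic]
  rcases lt_or_ge a 0 with h | h
  · have e1 : F ⁻¹' Set.Iic a = ∅ := by
      ext x; simp only [Set.mem_preimage, Set.mem_Iic, Set.mem_empty_iff_false, iff_false, not_le]
      exact h.trans_le (hge0 x)
    have e2 : Set.Iic a ∩ Set.Ico (0:ℝ) 1 = ∅ := by
      ext x; simp only [Set.mem_inter_iff, Set.mem_Iic, Set.mem_Ico, Set.mem_empty_iff_false,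
        iff_false]
      rintro ⟨p, q, -⟩; linarith
    rw [e1, lam, Measure.restrict_apply measurableSet_Iic, e2]; simp
  · rcases lt_or_ge a 1 with h1 | h1
    · rw [lam_Iic h h1.le]
      refine le_antisymm (key2 a h h1) ?_
      rcases h.eq_or_lt with h' | h'
      · rw [← h']; simp
      · exact (key a h' h1).2
    · have e1 : F ⁻¹' Set.Iic a = Set.univ := by
        ext x; simp only [Set.mem_preimage, Set.mem_Iic, Set.mem_univ, iff_true]
        exact (hle1 x).trans h1
      have e2 : Set.Iic a ∩ Set.Ico (0:ℝ) 1 = Set.Ico 0 1 := by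
        ext x; simp only [Set.mem_inter_iff, Set.mem_Iic, Set.mem_Ico, and_iff_right_iff_imp]
        rintro ⟨p, q⟩; linarith
      rw [e1, lam, Measure.restrict_apply measurableSet_Iic, e2]; simp

lemma lam_singleton (x : ℝ) : lam {x} = 0 := by
  rw [lam]; exact measure_singleton x

theorem xside {X : Type*} [MetricSpace X] [CompleteSpace X] [MeasurableSpace X] [BorelSpace X]
    (μ : Measure X) [IsProbabilityMeasure μ] [NullSingletonClass μ] (hμ : μ.InnerRegular) :
    ∃ (P : X → ℝ) (Q : ℝ → X), Measurable P ∧ Measurable Q ∧ μ.map P = lam ∧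
      ∀ᵐ x ∂μ, Q (P x) = x := by
  haveI : Nonempty X := μ.nonempty_of_neZero
  obtain ⟨D, hD, hμD⟩ := exists_sep μ hμ
  set Z := closure D with hZ
  have hZc : IsClosed Z := isClosed_closure
  haveI : TopologicalSpace.SeparableSpace Z :=
    (TopologicalSpace.IsSeparable.closure hD.isSeparable).separableSpace
  haveI : CompleteSpace Z := hZc.completeSpace_coe
  haveI : PolishSpace Z := inferInstance
  haveI : StandardBorelSpace Z := inferInstance
  obtain ⟨e, he⟩ := exists_measurableEmbedding_real Z
  obtain ⟨e', he', hee⟩ := (MeasurableEmbedding.subtype_coe hZc.measurableSet).exists_measurable_extend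
    he.measurable (fun _ => ⟨(0 : ℝ)⟩)
  have hee' : ∀ z : Z, e' z = e z := fun z => congrFun hee z
  haveI : IsProbabilityMeasure (μ.map e') := Measure.isProbabilityMeasure_map he'.aemeasurable
  haveI : NullSingletonClass (μ.map e') := ⟨fun c => by
    rw [Measure.map_apply he' (measurableSet_singleton c)]
    have hsub : (e' ⁻¹' {c} ∩ Z).Subsingleton := by
      rintro x ⟨hx, hxZ⟩ y ⟨hy, hyZ⟩
      have := he.injective ((hee' ⟨x, hxZ⟩).symm.trans (hx.trans (hy.symm.trans (hee' ⟨y, hyZ⟩))))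
      exact congrArg Subtype.val this
    have h1 : μ (e' ⁻¹' {c} ∩ Z) = 0 := hsub.measure_zero μ
    refine le_antisymm (le_trans ?_ h1.le) zero_le
    refine measure_mono_ae ?_
    filter_upwards [hμD] with x hx hx2
    exact ⟨hx2, hx⟩⟩
  set m := μ.map e' with hm
  set F := ProbabilityTheory.cdf m with hF
  have hmono : Monotone F := F.mono
  have hFm : Measurable F := hmono.measurable
  have hmap : m.map F = lam := map_cdf m
  set N : Set ℝ := ⋃ q : ℚ, F ⁻¹' {F q} with hN
  have hNm : MeasurableSet N := MeasurableSet.iUnion fun q => hFm (measurableSet_singleton _)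
  have hN0 : m N = 0 := by
    rw [hN, measure_iUnion_null_iff]
    intro q
    rw [← Measure.map_apply hFm (measurableSet_singleton _), hmap, lam_singleton]
  have hinj : ∀ x y, x ∉ N → x < y → F x ≠ F y := by
    intro x y hx hxy hE
    obtain ⟨q, h1, h2⟩ := exists_rat_btwn hxy
    refine hx (Set.mem_iUnion.2 ⟨q, ?_⟩)
    exact le_antisymm (hmono h1.le) ((hmono h2.le).trans hE.symm.le)
  set A : Set Z := e ⁻¹' Nᶜ with hA
  have hAm : MeasurableSet A := he.measurable hNm.compl
  haveI : StandardBorelSpace A := hAm.standardBorel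
  have hf : MeasurableEmbedding (fun z : A => F (e z)) := by
    refine Measurable.measurableEmbedding (hFm.comp (he.measurable.comp measurable_subtype_coe)) ?_
    intro z w hzw
    refine Subtype.ext (he.injective ?_)
    rcases lt_trichotomy (e z) (e w) with h | h | h
    · exact absurd hzw (hinj _ _ z.2 h)
    · exact h
    · exact absurd hzw.symm (hinj _ _ w.2 h)
  obtain ⟨Q, hQ, hQe⟩ := hf.exists_measurable_extend (g := fun z : A => ((z : Z) : X))
    (measurable_subtype_coe.comp measurable_subtype_coe) (fun _ => inferInstance)
  refine ⟨F ∘ e', Q, hFm.comp he', hQ, ?_, ?_⟩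
  · rw [← Measure.map_map hFm he', ← hm, hmap]
  · have h0 : ∀ᵐ x ∂μ, e' x ∉ N := by
      have : ∀ᵐ y ∂m, y ∉ N := measure_eq_zero_iff_ae_notMem.1 hN0
      exact ae_of_ae_map he'.aemeasurable this
    filter_upwards [hμD, h0] with x hx hxN
    have hxA : (⟨x, hx⟩ : Z) ∈ A := by
      show e ⟨x, hx⟩ ∉ N
      rw [← hee' ⟨x, hx⟩]; exact hxN
    have := congrFun hQe ⟨⟨x, hx⟩, hxA⟩
    simp only [Function.comp] at this ⊢
    rw [← hee' ⟨x, hx⟩] at this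
    exact this

end AMT
namespace AMT

def idx (n : ℕ) (u : ℝ) : Fin (2 ^ n) := ⟨⌊2 ^ n * u⌋₊ % 2 ^ n, Nat.mod_lt _ (by positivity)⟩

def pt (n : ℕ) (m : Fin (2 ^ n)) (r : ℝ) : ℝ := ((m : ℕ) + r) / 2 ^ n

lemma mul_pt (n : ℕ) (m : Fin (2 ^ n)) (r : ℝ) : 2 ^ n * pt n m r = r + (m : ℕ) := by
  rw [pt]; field_simp; ring

lemma pt_mem {n : ℕ} {m : Fin (2 ^ n)} {r : ℝ} (hr : r ∈ Set.Ico (0 : ℝ) 1) :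
    pt n m r ∈ Set.Ico (0 : ℝ) 1 := by
  have h0 : (0 : ℝ) < 2 ^ n := by positivity
  have h1 : ((m : ℕ) : ℝ) + 1 ≤ 2 ^ n := by exact_mod_cast m.2
  constructor
  · have := hr.1; unfold pt; positivity
  · unfold pt; rw [div_lt_one h0]; linarith [hr.2]

lemma idx_pt {n : ℕ} {m : Fin (2 ^ n)} {r : ℝ} (hr : r ∈ Set.Ico (0 : ℝ) 1) :
    idx n (pt n m r) = m := by
  apply Fin.ext
  simp only [idx]
  rw [mul_pt, Nat.floor_add_natCast hr.1, Nat.floor_eq_zero.2 hr.2, zero_add]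
  exact Nat.mod_eq_of_lt m.2

lemma fract_pt {n : ℕ} {m : Fin (2 ^ n)} {r : ℝ} (hr : r ∈ Set.Ico (0 : ℝ) 1) :
    Int.fract (2 ^ n * pt n m r) = r := by
  rw [mul_pt, Int.fract_add_natCast]
  exact Int.fract_eq_self.2 hr

lemma fract_mem (x : ℝ) : Int.fract x ∈ Set.Ico (0 : ℝ) 1 := ⟨Int.fract_nonneg x, Int.fract_lt_one x⟩

lemma pt_idx {n : ℕ} {u : ℝ} (hu : u ∈ Set.Ico (0 : ℝ) 1) :
    pt n (idx n u) (Int.fract (2 ^ n * u)) = u := by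
  have h0 : (0 : ℝ) < 2 ^ n := by positivity
  have h1 : (0 : ℝ) ≤ 2 ^ n * u := mul_nonneg h0.le hu.1
  have h2 : ⌊2 ^ n * u⌋₊ < 2 ^ n := by
    rw [Nat.floor_lt h1]; push_cast
    calc 2 ^ n * u < 2 ^ n * 1 := mul_lt_mul_of_pos_left hu.2 h0
      _ = 2 ^ n := mul_one _
  unfold pt idx
  simp only
  rw [Nat.mod_eq_of_lt h2, natCast_floor_eq_intCast_floor h1, Int.floor_add_fract]
  field_simp

lemma measurable_idx (n : ℕ) : Measurable (idx n) := by
  have h : Measurable fun u : ℝ => ⌊2 ^ n * u⌋₊ := Nat.measurable_floor.comp (measurable_const_mul _)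
  exact (Measurable.of_discrete
    (f := fun k : ℕ => (⟨k % 2 ^ n, Nat.mod_lt _ (by positivity)⟩ : Fin (2 ^ n)))).comp h

lemma measurable_pt (n : ℕ) (m : Fin (2 ^ n)) : Measurable (pt n m) := by
  unfold pt; fun_prop

lemma pt_image (n : ℕ) (m : Fin (2 ^ n)) :
    pt n m '' Set.Ico 0 1 = Set.Ico 0 1 ∩ idx n ⁻¹' {m} := by
  ext u; constructor
  · rintro ⟨r, hr, rfl⟩; exact ⟨pt_mem hr, idx_pt hr⟩
  · rintro ⟨h1, h2⟩
    refine ⟨_, fract_mem (2 ^ n * u), ?_⟩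
    have := pt_idx (n := n) h1
    rwa [show idx n u = m from h2] at this

/-- self-similarity of Lebesgue measure -/
lemma selfsim (n : ℕ) (f : ℝ → ENNReal) :
    ∫⁻ u, f u ∂lam = ∑ m : Fin (2 ^ n), ENNReal.ofReal (1 / 2 ^ n) * ∫⁻ r, f (pt n m r) ∂lam := by
  have h1 : (Set.Ico 0 1 : Set ℝ) = ⋃ m : Fin (2 ^ n), pt n m '' Set.Ico 0 1 := by
    ext u; simp [pt_image]
  have h2 : ∫⁻ u, f u ∂lam = ∑ m : Fin (2 ^ n), ∫⁻ u in pt n m '' Set.Ico 0 1, f u := by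
    conv_lhs => rw [lam, h1]
    rw [lintegral_iUnion, tsum_fintype]
    · intro m; rw [pt_image]
      exact measurableSet_Ico.inter (measurable_idx n (measurableSet_singleton m))
    · intro m m' hm
      rw [Function.onFun, pt_image, pt_image, Set.disjoint_left]
      rintro u ⟨-, a⟩ ⟨-, b⟩
      exact hm (a.symm.trans b)
  rw [h2]
  refine Finset.sum_congr rfl fun m _ => ?_
  rw [lintegral_image_eq_lintegral_abs_deriv_mul (f' := fun _ => 1 / 2 ^ n) measurableSet_Ico]
  · rw [← lintegral_const_mul' _ _ (by simp)]
    rw [abs_of_pos (by positivity)]; rfl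
  · intro x _
    have := ((hasDerivAt_id x).const_add ((m : ℕ) : ℝ)).div_const (2 ^ n)
    exact this.hasDerivWithinAt
  · intro x _ y _ hxy
    have := congrArg (fun z => (2 : ℝ) ^ n * z) hxy
    simp only [mul_pt] at this
    linarith

lemma sum_const_aux (n : ℕ) (c : ENNReal) :
    ∑ _m : Fin (2 ^ n), ENNReal.ofReal (1 / 2 ^ n) * c = c := by
  rw [Finset.sum_const, Finset.card_univ, Fintype.card_fin, nsmul_eq_mul, ← mul_assoc]
  have : ((2 ^ n : ℕ) : ENNReal) = ENNReal.ofReal (2 ^ n) := by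
    rw [ENNReal.ofReal_pow (by norm_num)]; simp
  rw [this, ← ENNReal.ofReal_mul (by positivity), mul_one_div_cancel (by positivity)]
  simp

lemma ae_lam_mem : ∀ᵐ u ∂lam, u ∈ Set.Ico (0 : ℝ) 1 := ae_restrict_mem measurableSet_Ico

lemma lintegral_congr_Ico {f g : ℝ → ENNReal} (h : ∀ u ∈ Set.Ico (0 : ℝ) 1, f u = g u) :
    ∫⁻ u, f u ∂lam = ∫⁻ u, g u ∂lam :=
  lintegral_congr_ae (ae_lam_mem.mono h)

/-- level-n measure preservation of an intertwined map -/
lemma lintegral_adapted (n : ℕ) (G : ℝ → ℝ) (p : ℝ → Equiv.Perm (Fin (2 ^ n)))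
    (hp : ∀ m, Measurable fun r => p r m)
    (hG : ∀ m, ∀ᵐ r ∂lam, G (pt n m r) = pt n (p r m) r) (f : ℝ → ENNReal) (hf : Measurable f) :
    ∫⁻ u, f (G u) ∂lam = ∫⁻ u, f u ∂lam := by
  have hm : ∀ m, Measurable fun r => f (pt n (p r m) r) := by
    intro m
    have h1 : Measurable fun q : Fin (2 ^ n) × ℝ => f (pt n q.1 q.2) :=
      measurable_from_prod_countable_right fun q => hf.comp (measurable_pt n q)
    exact h1.comp ((hp m).prodMk measurable_id)
  rw [selfsim n, selfsim n f, ← Finset.mul_sum, ← Finset.mul_sum]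
  congr 1
  have : ∀ m, ∫⁻ r, f (G (pt n m r)) ∂lam = ∫⁻ r, f (pt n (p r m) r) ∂lam := fun m =>
    lintegral_congr_ae ((hG m).mono fun r hr => by simp only [hr])
  rw [Finset.sum_congr rfl fun m _ => this m, ← lintegral_finsetSum _ fun m _ => hm m,
    ← lintegral_finsetSum (f := fun m r => f (pt n m r)) _ fun m _ => hf.comp (measurable_pt n m)]
  refine lintegral_congr fun r => ?_
  exact Equiv.sum_comp (p r) fun m => f (pt n m r)

lemma step_approx {Z : Type*} [MetricSpace Z] [MeasurableSpace Z] [BorelSpace Z] [Nonempty Z]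
    (f : ℝ → Z) (hf : Measurable f) (hr : (lam.map f).InnerRegular) (η : ℝ) (hη : 0 < η)
    (δ : ENNReal) (hδ : δ ≠ 0) :
    ∃ n₀, ∀ n ≥ n₀, ∃ q : Fin (2 ^ n) → Z, lam {u | η ≤ dist (q (idx n u)) (f u)} ≤ δ := by
  classical
  have hpr : IsProbabilityMeasure (lam.map f) := Measure.isProbabilityMeasure_map hf.aemeasurable
  have hδ2 : δ / 2 ≠ 0 := by simpa using hδ
  obtain ⟨K, -, hK, hKm⟩ := MeasurableSet.univ.exists_lt_isCompact (μ := lam.map f)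
      (r := 1 - δ / 2) (by
        rw [measure_univ]
        exact ENNReal.sub_lt_self (by simp) (by simp) hδ2)
  have hKc : lam (f ⁻¹' Kᶜ) ≤ δ / 2 := by
    rw [← Measure.map_apply hf hK.measurableSet.compl, prob_compl_eq_one_sub hK.measurableSet]
    rw [tsub_le_iff_right]
    have := tsub_le_iff_right.1 hKm.le
    rwa [add_comm] at this
  obtain ⟨t, -, htf, htK⟩ := hK.finite_cover_balls hη
  set l := htf.toFinset.toList with hl
  set z : ℕ → Z := fun i => l.getD i (Classical.arbitrary Z) with hz
  have hex : ∀ u : ℝ, ∃ i, l.length ≤ i ∨ dist (z i) (f u) < η := fun u => ⟨l.length, Or.inl le_rfl⟩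
  set A : ℝ → ℕ := fun u => Nat.find (hex u) with hA
  have hAm : Measurable A := by
    refine measurable_find hex fun k => ?_
    refine MeasurableSet.union (MeasurableSet.const _) ?_
    exact measurableSet_lt
      ((continuous_const.dist continuous_id : Continuous fun y => dist (z k) y).measurable.comp hf)
      measurable_const
  have hAl : ∀ u, A u ≤ l.length := fun u => Nat.find_min' (hex u) (Or.inl le_rfl)
  have hAK : ∀ u, f u ∈ K → dist (z (A u)) (f u) < η := by
    intro u hu
    obtain ⟨x, hxt, hx⟩ := Set.mem_iUnion₂.1 (htK hu)
    have hxl : x ∈ l := by rw [hl, Finset.mem_toList]; simpa using hxt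
    obtain ⟨i, hi, hix⟩ := List.getElem_of_mem hxl
    have hzi : z i = x := by simp [hz, hi, hix]
    have hle : A u ≤ i := Nat.find_min' (hex u) (Or.inr (by
      rw [hzi, dist_comm]; exact hx))
    rcases Nat.find_spec (hex u) with h | h
    · exact absurd (h.trans hle) (not_le.2 hi)
    · exact h
  have hAi : Integrable (fun u => (A u : ℝ)) lam := by
    refine Integrable.of_bound (C := l.length)
      ((measurable_from_nat (f := fun k : ℕ => (k : ℝ))).comp hAm).aestronglyMeasurable ?_
    refine ae_of_all _ fun u => ?_
    rw [Real.norm_of_nonneg (by positivity)]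
    exact_mod_cast hAl u
  have hε : δ / 2 * ENNReal.ofReal (1 / 4) ≠ 0 := mul_ne_zero hδ2 (by simp)
  obtain ⟨g, hgc, hgi, hg, hgint⟩ := hAi.exists_hasCompactSupport_lintegral_sub_le hε
  have huc := hgc.uniformContinuous_of_continuous hg
  obtain ⟨d, hd, hdg⟩ := Metric.uniformContinuous_iff.1 huc (1 / 4) (by norm_num)
  obtain ⟨n₀, hn₀⟩ := exists_pow_lt_of_lt_one hd (by norm_num : (1 / 2 : ℝ) < 1)
  refine ⟨n₀, fun n hn => ⟨fun i => z (round (g (pt n i 0))).toNat, ?_⟩⟩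
  have hmark : lam {u | ENNReal.ofReal (1 / 4) ≤ ‖(A u : ℝ) - g u‖ₑ} ≤ δ / 2 := by
    have h1 := meas_ge_le_lintegral_div (μ := lam) (f := fun u => ‖(A u : ℝ) - g u‖ₑ)
      (hAi.sub hgint).aestronglyMeasurable.enorm (ε := ENNReal.ofReal (1 / 4)) (by simp) (by simp)
    refine h1.trans ?_
    exact ENNReal.div_le_of_le_mul hgi
  have hsub : {u | η ≤ dist (z (round (g (pt n (idx n u) 0))).toNat) (f u)} ≤ᵐ[lam]
      (f ⁻¹' Kᶜ ∪ {u | ENNReal.ofReal (1 / 4) ≤ ‖(A u : ℝ) - g u‖ₑ} : Set ℝ) := by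
    filter_upwards [ae_lam_mem] with u hu hbad
    by_contra hcon
    have h1 : f u ∈ K := by
      by_contra h; exact hcon (Or.inl h)
    have h2 : ‖(A u : ℝ) - g u‖ₑ < ENNReal.ofReal (1 / 4) := by
      by_contra h; exact hcon (Or.inr (not_lt.1 h))
    rw [← ofReal_norm_eq_enorm, ENNReal.ofReal_lt_ofReal_iff (by norm_num), Real.norm_eq_abs] at h2
    have h3 : dist (pt n (idx n u) 0) u < d := by
      have h4 : u - pt n (idx n u) 0 = Int.fract (2 ^ n * u) / 2 ^ n := by
        conv_lhs => rw [← pt_idx (n := n) hu]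
        rw [idx_pt (fract_mem _)]
        unfold pt; ring
      rw [dist_comm, Real.dist_eq, h4, abs_of_nonneg (div_nonneg (Int.fract_nonneg _) (by positivity))]
      refine lt_of_le_of_lt ?_ hn₀
      calc Int.fract (2 ^ n * u) / 2 ^ n ≤ 1 / 2 ^ n := by
            gcongr; exact (Int.fract_lt_one _).le
        _ = (1 / 2 : ℝ) ^ n := by rw [one_div_pow]
        _ ≤ (1 / 2 : ℝ) ^ n₀ := pow_le_pow_of_le_one (by norm_num) (by norm_num) hn
    have h5 := hdg h3
    rw [Real.dist_eq] at h5
    have h6 : round (g (pt n (idx n u) 0)) = (A u : ℤ) := by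
      rw [round_eq, Int.floor_eq_iff]
      have := abs_lt.1 h5
      have := abs_lt.1 h2
      push_cast
      constructor <;> linarith
    have hbad' : η ≤ dist (z (round (g (pt n (idx n u) 0))).toNat) (f u) := hbad
    rw [h6, Int.toNat_natCast] at hbad'
    exact absurd (hAK u h1) (not_lt.2 hbad')
  calc _ ≤ lam (f ⁻¹' Kᶜ ∪ {u | ENNReal.ofReal (1 / 4) ≤ ‖(A u : ℝ) - g u‖ₑ}) := measure_mono_ae hsub
    _ ≤ δ / 2 + δ / 2 := (measure_union_le _ _).trans (add_le_add hKc hmark)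
    _ = δ := ENNReal.add_halves δ

end AMT
namespace AMT

lemma aesm {Z : Type*} [MetricSpace Z] [MeasurableSpace Z] [BorelSpace Z] (f : ℝ → Z)
    (hf : Measurable f) (hr : (lam.map f).InnerRegular) : AEStronglyMeasurable f lam := by
  have hpr : IsProbabilityMeasure (lam.map f) := Measure.isProbabilityMeasure_map hf.aemeasurable
  obtain ⟨D, hD, hD2⟩ := exists_sep (lam.map f) hr
  refine aestronglyMeasurable_iff_aemeasurable_separable.2 ⟨hf.aemeasurable, closure D,
    hD.isSeparable.closure, ae_of_ae_map hf.aemeasurable hD2⟩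

lemma tendsto_bad {Y T : Type*} [MetricSpace Y] [MeasurableSpace Y] [BorelSpace Y] [MetricSpace T]
    (S : T → ℝ → Y) (hS : ∀ t, Measurable (S t)) (hr : ∀ t, (lam.map (S t)).InnerRegular)
    (hSc : ∀ (t : T) (tn : ℕ → T), Tendsto tn atTop (𝓝 t) →
        ∀ᵐ v ∂lam, Tendsto (fun n => S (tn n) v) atTop (𝓝 (S t v))) (t₀ : T) (η : ℝ) (hη : 0 < η) :
    Tendsto (fun t => lam {v | η ≤ dist (S t v) (S t₀ v)}) (𝓝 t₀) (𝓝 0) := by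
  refine tendsto_of_seq_tendsto fun tn htn => ?_
  have h := tendstoInMeasure_of_tendsto_ae (fun n => aesm (S (tn n)) (hS _) (hr _)) (hSc t₀ tn htn)
  exact tendstoInMeasure_iff_dist.1 h η hη

lemma compact_bound {Z : Type*} [MetricSpace Z] [MeasurableSpace Z] [BorelSpace Z]
    (f : ℝ → Z) (hf : Measurable f) (hr : (lam.map f).InnerRegular)
    (δ : ENNReal) (hδ : δ ≠ 0) : ∃ K : Set Z, IsCompact K ∧ lam (f ⁻¹' Kᶜ) ≤ δ := by
  have hpr : IsProbabilityMeasure (lam.map f) := Measure.isProbabilityMeasure_map hf.aemeasurable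
  obtain ⟨K, -, hK, hKm⟩ := MeasurableSet.univ.exists_lt_isCompact (μ := lam.map f)
      (r := 1 - δ) (by
        rw [measure_univ]
        exact ENNReal.sub_lt_self (by simp) (by simp) hδ)
  refine ⟨K, hK, ?_⟩
  rw [← Measure.map_apply hf hK.measurableSet.compl, prob_compl_eq_one_sub hK.measurableSet]
  rw [tsub_le_iff_right]
  have := tsub_le_iff_right.1 hKm.le
  rwa [add_comm] at this

lemma lint_tail {Z : Type*} [MeasurableSpace Z] (m : Measure Z) (Q : ℝ → Z) (hQ : Measurable Q)
    (hm : lam.map Q = m) (c : Z → ℝ) (hc : Measurable c) (hc0 : ∀ z, 0 ≤ c z) (hi : Integrable c m)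
    (R : ℝ) :
    ∫⁻ u, ENNReal.ofReal (Set.indicator {z | R ≤ c z} c (Q u)) ∂lam =
      ENNReal.ofReal (∫ z in {z | R ≤ c z}, c z ∂m) := by
  have hms : MeasurableSet {z | R ≤ c z} := measurableSet_le measurable_const hc
  rw [← integral_indicator hms, ofReal_integral_eq_lintegral_ofReal (hi.indicator hms)
    (ae_of_all _ fun z => Set.indicator_nonneg (fun z _ => hc0 z) z), ← hm,
    lintegral_map (hc.indicator hms).ennreal_ofReal hQ]

lemma le_tail {Z : Type*} (c : Z → ℝ) (hc0 : ∀ z, 0 ≤ c z) (R : ℝ) (hR : 0 ≤ R) (z : Z) :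
    c z ≤ R + Set.indicator {z | R ≤ c z} c z := by
  by_cases h : R ≤ c z
  · rw [Set.indicator_of_mem (show z ∈ {z | R ≤ c z} from h)]; linarith
  · rw [Set.indicator_of_notMem (show z ∉ {z | R ≤ c z} from h)]; linarith

theorem mainN {X Y T : Type*} [MetricSpace X] [MetricSpace Y]
    [MetricSpace T] [MeasurableSpace X] [BorelSpace X] [MeasurableSpace Y] [BorelSpace Y]
    [Nonempty X] [Nonempty Y]
    (μ : Measure X) (ν : T → Measure Y)
    (hμr : μ.InnerRegular) (hνr : ∀ t, (ν t).InnerRegular)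
    (h : X → Y → T → ℝ)
    (hcont : Continuous fun p : X × Y × T => h p.1 p.2.1 p.2.2)
    (hnonneg : ∀ x y t, 0 ≤ h x y t)
    (a : T → X → ℝ) (b : T → Y → ℝ)
    (hameas : ∀ t, Measurable (a t)) (hbmeas : ∀ t, Measurable (b t))
    (ha0 : ∀ t x, 0 ≤ a t x) (hb0 : ∀ t y, 0 ≤ b t y)
    (haint : ∀ t, Integrable (a t) μ) (hbint : ∀ t, Integrable (b t) (ν t))
    (hdom : ∀ t x y, h x y t ≤ a t x + b t y)
    (hunif : ∀ ε > (0 : ℝ), ∃ R₀ : ℝ, ∀ R ≥ R₀, ∀ t : T,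
      (∫ x in {x | R ≤ a t x}, a t x ∂μ) + ∫ y in {y | R ≤ b t y}, b t y ∂(ν t) ≤ ε)
    (Q : ℝ → X) (hQ : Measurable Q) (hQμ : lam.map Q = μ)
    (S : T → ℝ → Y) (hS : ∀ t, Measurable (S t)) (hSν : ∀ t, lam.map (S t) = ν t)
    (hSc : ∀ (t : T) (tn : ℕ → T), Tendsto tn atTop (𝓝 t) →
        ∀ᵐ v ∂lam, Tendsto (fun n => S (tn n) v) atTop (𝓝 (S t v)))
    (t₀ : T) (ε : ℝ) (hε : 0 < ε) :
    ∃ (n : ℕ) (C : Fin (2 ^ n) → Fin (2 ^ n) → ℝ), (∀ i j, 0 ≤ C i j) ∧ ∀ᶠ t in 𝓝 t₀,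
      ∃ α β : ℝ → ENNReal, Measurable α ∧ Measurable β ∧
        ∫⁻ u, α u ∂lam + ∫⁻ v, β v ∂lam ≤ ENNReal.ofReal ε ∧
        ∀ u v, ENNReal.ofReal (h (Q u) (S t v) t) ≤
            ENNReal.ofReal (C (idx n u) (idx n v)) + (α u + β v) ∧
          ENNReal.ofReal (C (idx n u) (idx n v)) ≤
            ENNReal.ofReal (h (Q u) (S t v) t) + (α u + β v) := by
  have hQr : (lam.map Q).InnerRegular := hQμ ▸ hμr
  have hSr : ∀ t, (lam.map (S t)).InnerRegular := fun t => (hSν t).symm ▸ hνr t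
  obtain ⟨R₀, hR₀⟩ := hunif (ε / 4) (by linarith)
  set R := max R₀ 1 with hRdef
  have hR1 : 1 ≤ R := le_max_right _ _
  have hR0 : 0 < R := by linarith
  set δ : ENNReal := ENNReal.ofReal (ε / (20 * R)) with hδd
  have hδ : δ ≠ 0 := by
    rw [hδd, ne_eq, ENNReal.ofReal_eq_zero, not_le]; positivity
  obtain ⟨K, hK, hKm⟩ := compact_bound Q hQ hQr δ hδ
  obtain ⟨L, hL, hLm⟩ := compact_bound (S t₀) (hS t₀) (hSr t₀) δ hδ
  obtain ⟨η, hη, hηh⟩ : ∃ η > 0, ∀ x ∈ K, ∀ y ∈ L, ∀ x' y' t', dist x x' < η → dist y y' < η →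
      dist t₀ t' < η → |h x y t₀ - h x' y' t'| < ε / 8 := by
    have hc : IsCompact (K ×ˢ (L ×ˢ ({t₀} : Set T))) := hK.prod (hL.prod isCompact_singleton)
    have := hc.uniformContinuousAt_of_continuousAt
      (fun p : X × Y × T => h p.1 p.2.1 p.2.2) (fun p _ => hcont.continuousAt)
      (Metric.dist_mem_uniformity (show 0 < ε / 8 by linarith))
    obtain ⟨η, hη, H⟩ := Metric.mem_uniformity_dist.1 this
    refine ⟨η, hη, fun x hx y hy x' y' t' h1 h2 h3 => ?_⟩
    have := H (a := (x, y, t₀)) (b := (x', y', t'))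
      (by rw [Prod.dist_eq, Prod.dist_eq]; exact max_lt h1 (max_lt h2 h3)) ⟨hx, hy, rfl⟩
    simpa [Real.dist_eq] using this
  obtain ⟨n₁, hn₁⟩ := step_approx Q hQ hQr η hη δ hδ
  obtain ⟨n₂, hn₂⟩ := step_approx (S t₀) (hS t₀) (hSr t₀) η hη δ hδ
  set n := max n₁ n₂
  obtain ⟨q, hq⟩ := hn₁ n (le_max_left _ _)
  obtain ⟨s, hs⟩ := hn₂ n (le_max_right _ _)
  refine ⟨n, fun i j => min (h (q i) (s j) t₀) (2 * R), fun i j => le_min (hnonneg _ _ _)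
    (by linarith), ?_⟩
  have hev1 := (tendsto_bad S hS hSr hSc t₀ η hη).eventually (ge_mem_nhds hδ.bot_lt)
  have hev2 : ∀ᶠ t in 𝓝 t₀, dist t₀ t < η := by
    filter_upwards [Metric.ball_mem_nhds t₀ hη] with t ht
    rw [dist_comm]; exact ht
  filter_upwards [hev1, hev2] with t ht1 ht2
  set Bu : Set ℝ := Q ⁻¹' Kᶜ ∪ {u | η ≤ dist (q (idx n u)) (Q u)} with hBu
  set Bv : Set ℝ := S t₀ ⁻¹' Lᶜ ∪ {v | η ≤ dist (s (idx n v)) (S t₀ v)} ∪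
    {v | η ≤ dist (S t v) (S t₀ v)} with hBv
  have hBum : lam Bu ≤ δ + δ := (measure_union_le _ _).trans (add_le_add hKm hq)
  have hBvm : lam Bv ≤ δ + δ + δ := (measure_union_le _ _).trans
    (add_le_add ((measure_union_le _ _).trans (add_le_add hLm hs)) ht1)
  set M : ENNReal := ENNReal.ofReal (2 * R) with hM
  have hMδ : M * δ = ENNReal.ofReal (ε / 10) := by
    rw [hM, hδd, ← ENNReal.ofReal_mul (by linarith)]; congr 1; field_simp; norm_num
  set Iu := Set.indicator (toMeasurable lam Bu) (fun _ => M) with hIu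
  set Iv := Set.indicator (toMeasurable lam Bv) (fun _ => M) with hIv
  have hIum : Measurable Iu := measurable_const.indicator (measurableSet_toMeasurable _ _)
  have hIvm : Measurable Iv := measurable_const.indicator (measurableSet_toMeasurable _ _)
  have hIui : ∫⁻ u, Iu u ∂lam ≤ ENNReal.ofReal (ε / 10) + ENNReal.ofReal (ε / 10) := by
    rw [hIu, lintegral_indicator_const (measurableSet_toMeasurable _ _), measure_toMeasurable, ← hMδ,
      ← mul_add]
    gcongr
  have hIvi : ∫⁻ u, Iv u ∂lam ≤
      ENNReal.ofReal (ε / 10) + ENNReal.ofReal (ε / 10) + ENNReal.ofReal (ε / 10) := by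
    rw [hIv, lintegral_indicator_const (measurableSet_toMeasurable _ _), measure_toMeasurable, ← hMδ,
      ← mul_add, ← mul_add]
    gcongr
  set ta := fun u => ENNReal.ofReal (Set.indicator {x | R ≤ a t x} (a t) (Q u)) with hta
  set tb := fun v => ENNReal.ofReal (Set.indicator {y | R ≤ b t y} (b t) (S t v)) with htb
  have htam : Measurable ta := (((hameas t).indicator
    (measurableSet_le measurable_const (hameas t))).comp hQ).ennreal_ofReal
  have htbm : Measurable tb := (((hbmeas t).indicator
    (measurableSet_le measurable_const (hbmeas t))).comp (hS t)).ennreal_ofReal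
  have hti : ∫⁻ u, ta u ∂lam + ∫⁻ v, tb v ∂lam ≤ ENNReal.ofReal (ε / 4) := by
    rw [hta, htb, lint_tail μ Q hQ hQμ (a t) (hameas t) (ha0 t) (haint t),
      lint_tail (ν t) (S t) (hS t) (hSν t) (b t) (hbmeas t) (hb0 t) (hbint t),
      ← ENNReal.ofReal_add]
    · exact ENNReal.ofReal_le_ofReal (hR₀ R (le_max_left _ _) t)
    · exact setIntegral_nonneg (measurableSet_le measurable_const (hameas t)) fun x _ => ha0 t x
    · exact setIntegral_nonneg (measurableSet_le measurable_const (hbmeas t)) fun x _ => hb0 t x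
  refine ⟨fun u => ENNReal.ofReal (ε / 4) + Iu u + ta u, fun v => Iv v + tb v, ?_, ?_, ?_, ?_⟩
  · exact (measurable_const.add hIum).add htam
  · exact hIvm.add htbm
  · rw [lintegral_add_right _ htam, lintegral_add_right _ hIum, lintegral_add_right _ htbm,
      lintegral_const, measure_univ, mul_one]
    calc _ = ENNReal.ofReal (ε / 4) + (∫⁻ u, Iu u ∂lam + ∫⁻ u, Iv u ∂lam) +
          (∫⁻ u, ta u ∂lam + ∫⁻ v, tb v ∂lam) := by ring
      _ ≤ ENNReal.ofReal (ε / 4) + (ENNReal.ofReal (ε / 10) + ENNReal.ofReal (ε / 10) +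
          (ENNReal.ofReal (ε / 10) + ENNReal.ofReal (ε / 10) + ENNReal.ofReal (ε / 10))) +
          ENNReal.ofReal (ε / 4) := by gcongr
      _ = ENNReal.ofReal ε := by
        have h1 : 0 ≤ ε / 10 := by linarith
        have h2 : 0 ≤ ε / 4 := by linarith
        rw [← ENNReal.ofReal_add h1 h1, ← ENNReal.ofReal_add (by linarith) h1,
          ← ENNReal.ofReal_add (by linarith) (by linarith),
          ← ENNReal.ofReal_add h2 (by linarith), ← ENNReal.ofReal_add (by linarith) h2]
        congr 1; ring
  · intro u v
    have hub : ENNReal.ofReal (h (Q u) (S t v) t) ≤ M + (ta u + tb v) := by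
      have e1 := le_tail (a t) (ha0 t) R hR0.le (Q u)
      have e2 := le_tail (b t) (hb0 t) R hR0.le (S t v)
      have e3 := hdom t (Q u) (S t v)
      have e4 : h (Q u) (S t v) t ≤ 2 * R + (Set.indicator {x | R ≤ a t x} (a t) (Q u) +
        Set.indicator {y | R ≤ b t y} (b t) (S t v)) := by linarith
      refine (ENNReal.ofReal_le_ofReal e4).trans ?_
      exact ENNReal.ofReal_add_le.trans (add_le_add le_rfl ENNReal.ofReal_add_le)
    have hCM : ENNReal.ofReal (min (h (q (idx n u)) (s (idx n v)) t₀) (2 * R)) ≤ M :=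
      ENNReal.ofReal_le_ofReal (min_le_right _ _)
    by_cases hu : u ∈ Bu
    · have : Iu u = M := Set.indicator_of_mem (subset_toMeasurable _ _ hu) _
      simp only [this]
      constructor
      · refine hub.trans ?_
        calc M + (ta u + tb v) ≤ M + (ta u + tb v) + (ENNReal.ofReal (min (h (q (idx n u)) (s (idx n v)) t₀) (2 * R)) + ENNReal.ofReal (ε / 4) + Iv v) := le_self_add
          _ = _ := by ring
      · refine hCM.trans ?_
        calc M ≤ M + (ENNReal.ofReal (h (Q u) (S t v) t) + ENNReal.ofReal (ε / 4) + ta u + Iv v + tb v) := le_self_add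
          _ = _ := by ring
    by_cases hv : v ∈ Bv
    · have : Iv v = M := Set.indicator_of_mem (subset_toMeasurable _ _ hv) _
      simp only [this]
      constructor
      · refine hub.trans ?_
        calc M + (ta u + tb v) ≤ M + (ta u + tb v) + (ENNReal.ofReal (min (h (q (idx n u)) (s (idx n v)) t₀) (2 * R)) + ENNReal.ofReal (ε / 4) + Iu u) := le_self_add
          _ = _ := by ring
      · refine hCM.trans ?_
        calc M ≤ M + (ENNReal.ofReal (h (Q u) (S t v) t) + ENNReal.ofReal (ε / 4) + ta u + Iu u + tb v) := le_self_add
          _ = _ := by ring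
    simp only [hBu, hBv, Set.mem_union, Set.mem_preimage, Set.mem_compl_iff, Set.mem_ofPred_eq, not_or,
      not_not, not_le] at hu hv
    have k1 := abs_lt.1 (hηh _ hu.1 _ hv.1.1 (Q u) (S t v) t (by rw [dist_self]; exact hη)
      (by rw [dist_comm]; exact hv.2) ht2)
    have k2 := abs_lt.1 (hηh _ hu.1 _ hv.1.1 (q (idx n u)) (s (idx n v)) t₀
      (by rw [dist_comm]; exact hu.2) (by rw [dist_comm]; exact hv.1.2) (by rw [dist_self]; exact hη))
    constructor
    · rcases le_total (h (q (idx n u)) (s (idx n v)) t₀) (2 * R) with hc | hc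
      · simp only [min_eq_left hc]
        calc ENNReal.ofReal (h (Q u) (S t v) t) ≤
            ENNReal.ofReal (h (q (idx n u)) (s (idx n v)) t₀ + ε / 4) :=
              ENNReal.ofReal_le_ofReal (by linarith)
          _ ≤ ENNReal.ofReal (h (q (idx n u)) (s (idx n v)) t₀) + ENNReal.ofReal (ε / 4) :=
            ENNReal.ofReal_add_le
          _ ≤ ENNReal.ofReal (h (q (idx n u)) (s (idx n v)) t₀) + ENNReal.ofReal (ε / 4) +
            (Iu u + ta u + Iv v + tb v) := le_self_add
          _ = _ := by ring
      · simp only [min_eq_right hc]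
        refine hub.trans ?_
        calc M + (ta u + tb v) ≤ M + (ta u + tb v) + (ENNReal.ofReal (ε / 4) + Iu u + Iv v) :=
              le_self_add
          _ = _ := by ring
    · calc _ ≤ ENNReal.ofReal (h (Q u) (S t v) t + ε / 4) :=
              ENNReal.ofReal_le_ofReal ((min_le_left _ _).trans (by linarith))
          _ ≤ ENNReal.ofReal (h (Q u) (S t v) t) + ENNReal.ofReal (ε / 4) :=
            ENNReal.ofReal_add_le
          _ ≤ ENNReal.ofReal (h (Q u) (S t v) t) + ENNReal.ofReal (ε / 4) +
            (Iu u + ta u + Iv v + tb v) := le_self_add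
          _ = _ := by ring

end AMT
namespace AMT

lemma eq_of_dist {Y : Type*} [MetricSpace Y] {D : Set Y} {y y' : Y} (hy : y ∈ closure D)
    (h : ∀ z ∈ D, dist y z = dist y' z) : y = y' := by
  refine (eq_of_forall_dist_le fun ε hε => ?_)
  obtain ⟨z, hz, hd⟩ := Metric.mem_closure_iff.1 hy (ε / 2) (by linarith)
  have := h z hz
  have h3 := dist_triangle_right y y' z
  linarith

lemma aemeas_cost {X Y : Type*} [MetricSpace X] [MetricSpace Y]
    [MeasurableSpace X] [BorelSpace X] [MeasurableSpace Y] [BorelSpace Y]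
    (μ : Measure X) (ν : Measure Y) [IsProbabilityMeasure μ] [IsProbabilityMeasure ν]
    (hμ : μ.InnerRegular) (hν : ν.InnerRegular) (c : X → Y → ℝ)
    (hc : Continuous fun p : X × Y => c p.1 p.2) (σ : Measure (X × Y)) (hσ1 : σ.map Prod.fst = μ)
    (hσ2 : σ.map Prod.snd = ν) : AEMeasurable (fun p : X × Y => ENNReal.ofReal (c p.1 p.2)) σ := by
  obtain ⟨D, hD, hDμ⟩ := exists_sep μ hμ
  obtain ⟨E, hE, hEν⟩ := exists_sep ν hν
  have hs : TopologicalSpace.SeparableSpace (closure D) := hD.isSeparable.closure.separableSpace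
  have hs' : TopologicalSpace.SeparableSpace (closure E) := hE.isSeparable.closure.separableSpace
  have hs2 : SecondCountableTopology (closure D) := UniformSpace.secondCountable_of_separable _
  have hs2' : SecondCountableTopology (closure E) := UniformSpace.secondCountable_of_separable _
  have hA : MeasurableSet (closure D ×ˢ closure E) :=
    isClosed_closure.measurableSet.prod isClosed_closure.measurableSet
  have hae : ∀ᵐ p ∂σ, p ∈ closure D ×ˢ closure E := by
    rw [← hσ1] at hDμ
    rw [← hσ2] at hEν
    filter_upwards [ae_of_ae_map measurable_fst.aemeasurable hDμ,
      ae_of_ae_map measurable_snd.aemeasurable hEν] with p h1 h2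
    exact ⟨h1, h2⟩
  rw [← Measure.restrict_eq_self_of_ae_mem hae]
  refine aemeasurable_restrict_of_measurable_subtype hA ?_
  have h1 : Measurable fun q : closure D × closure E => ENNReal.ofReal (c q.1 q.2) := by
    have : Continuous fun q : closure D × closure E => c q.1 q.2 :=
      hc.comp ((continuous_subtype_val.comp continuous_fst).prodMk
        (continuous_subtype_val.comp continuous_snd))
    exact this.measurable.ennreal_ofReal
  have h2 : Measurable fun e : ↥(closure D ×ˢ closure E) =>
      ((⟨e.1.1, e.2.1⟩, ⟨e.1.2, e.2.2⟩) : closure D × closure E) :=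
    ((measurable_fst.comp measurable_subtype_coe).subtype_mk).prodMk
      ((measurable_snd.comp measurable_subtype_coe).subtype_mk)
  exact h1.comp h2

theorem lift_coupling {X Y : Type*} [MetricSpace X] [MetricSpace Y]
    [MeasurableSpace X] [BorelSpace X] [MeasurableSpace Y] [BorelSpace Y]
    (μ : Measure X) (ν : Measure Y) [IsProbabilityMeasure μ] [IsProbabilityMeasure ν]
    (hμ : μ.InnerRegular) (hν : ν.InnerRegular) (c : X → Y → ℝ)
    (hc : Continuous fun p : X × Y => c p.1 p.2) (σ : Measure (X × Y)) (hσ1 : σ.map Prod.fst = μ)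
    (hσ2 : σ.map Prod.snd = ν)
    (P : X → ℝ) (hP : Measurable P) (hPμ : μ.map P = lam) (Q : ℝ → X)
    (hQP : ∀ᵐ x ∂μ, Q (P x) = x) (S : ℝ → Y) (hS : Measurable S) (hSν : lam.map S = ν) :
    ∃ γ : Measure (ℝ × ℝ), γ.map Prod.fst = lam ∧ γ.map Prod.snd = lam ∧
      ∫⁻ p, ENNReal.ofReal (c (Q p.1) (S p.2)) ∂γ ≤ ∫⁻ p, ENNReal.ofReal (c p.1 p.2) ∂σ := by
  have hσp : IsProbabilityMeasure σ := by
    constructor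
    have : σ.map Prod.fst Set.univ = 1 := by rw [hσ1]; exact measure_univ
    rwa [Measure.map_apply measurable_fst MeasurableSet.univ, Set.preimage_univ] at this
  have hgr : Measurable fun v => (S v, v) := hS.prodMk measurable_id
  set ρ : Measure (Y × ℝ) := lam.map fun v => (S v, v) with hρ
  have hρp : IsProbabilityMeasure ρ := Measure.isProbabilityMeasure_map hgr.aemeasurable
  have hρ1 : ρ.fst = ν := by
    rw [Measure.fst, hρ, Measure.map_map measurable_fst hgr]; exact hSν
  have hρ2 : ρ.map Prod.snd = lam := by
    rw [hρ, Measure.map_map measurable_snd hgr]; exact Measure.map_id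
  set κ := ρ.condKernel with hκ
  have hdis : ν.compProd κ = ρ := by rw [← hρ1]; exact ρ.disintegrate κ
  set κ' := κ.comap (Prod.snd : X × Y → Y) measurable_snd with hκ'
  set G : Measure ((X × Y) × ℝ) := σ.compProd κ' with hG
  have hg1 : Measurable fun q : (X × Y) × ℝ => (q.1.2, q.2) := by fun_prop
  have hGρ : G.map (fun q : (X × Y) × ℝ => (q.1.2, q.2)) = ρ := by
    ext A hA
    rw [Measure.map_apply hg1 hA, ← hdis, Measure.compProd_apply hA, hG,
      Measure.compProd_apply (hg1 hA), ← hσ2,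
      lintegral_map (ProbabilityTheory.Kernel.measurable_kernel_prodMk_left hA) measurable_snd]
    rfl
  have hGσ : G.map Prod.fst = σ := by
    have := Measure.fst_compProd σ κ'
    exact this
  obtain ⟨D, hD, hDν⟩ := exists_sep ν hν
  have hae1 : ∀ᵐ q ∂G, S q.2 = q.1.2 := by
    have hm : MeasurableSet {p : Y × ℝ | p.1 ∈ closure D ∧ ∀ z ∈ D, dist p.1 z = dist (S p.2) z} := by
      refine MeasurableSet.inter (measurable_fst isClosed_closure.measurableSet) ?_
      have : {p : Y × ℝ | ∀ z ∈ D, dist p.1 z = dist (S p.2) z} =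
        ⋂ z ∈ D, {p : Y × ℝ | dist p.1 z = dist (S p.2) z} := by ext; simp
      show MeasurableSet {p : Y × ℝ | ∀ z ∈ D, dist p.1 z = dist (S p.2) z}
      rw [this]
      refine MeasurableSet.biInter hD fun z _ => ?_
      have hdz : Measurable fun y : Y => dist y z := (continuous_id.dist continuous_const).measurable
      exact measurableSet_eq_fun (hdz.comp measurable_fst) (hdz.comp (hS.comp measurable_snd))
    have h1 : ∀ᵐ p ∂ρ, p.1 ∈ closure D ∧ ∀ z ∈ D, dist p.1 z = dist (S p.2) z := by
      rw [hρ, ae_map_iff hgr.aemeasurable hm]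
      rw [← hSν] at hDν
      filter_upwards [ae_of_ae_map hS.aemeasurable hDν] with v hv
      exact ⟨hv, fun z _ => rfl⟩
    rw [← hGρ] at h1
    filter_upwards [ae_of_ae_map hg1.aemeasurable h1] with q hq
    exact (eq_of_dist hq.1 hq.2).symm
  have hae2 : ∀ᵐ q ∂G, Q (P q.1.1) = q.1.1 := by
    rw [← hσ1] at hQP
    have := ae_of_ae_map measurable_fst.aemeasurable hQP
    rw [← hGσ] at this
    exact ae_of_ae_map measurable_fst.aemeasurable this
  have hg : Measurable fun q : (X × Y) × ℝ => (P q.1.1, q.2) :=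
    (hP.comp (measurable_fst.comp measurable_fst)).prodMk measurable_snd
  refine ⟨G.map fun q => (P q.1.1, q.2), ?_, ?_, ?_⟩
  · rw [Measure.map_map measurable_fst hg, ← hPμ, ← hσ1, ← hGσ,
      Measure.map_map measurable_fst measurable_fst,
      Measure.map_map hP (measurable_fst.comp measurable_fst)]
    rfl
  · rw [Measure.map_map measurable_snd hg, ← hρ2, ← hGρ, Measure.map_map measurable_snd hg1]
    rfl
  · refine (lintegral_map_le _ _).trans ?_
    have haem := aemeas_cost μ ν hμ hν c hc σ hσ1 hσ2
    rw [← hGσ] at haem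
    conv_rhs => rw [← hGσ]
    rw [lintegral_map' haem measurable_fst.aemeasurable]
    refine (lintegral_congr_ae ?_).le
    filter_upwards [hae1, hae2] with q h1 h2
    simp only [h1, h2]

end AMT
namespace AMT

def gmap (n : ℕ) (p : Equiv.Perm (Fin (2 ^ n))) (u : ℝ) : ℝ :=
  pt n (p (idx n u)) (Int.fract (2 ^ n * u))

lemma gmap_pt {n : ℕ} (p : Equiv.Perm (Fin (2 ^ n))) {m : Fin (2 ^ n)} {r : ℝ}
    (hr : r ∈ Set.Ico (0 : ℝ) 1) : gmap n p (pt n m r) = pt n (p m) r := by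
  rw [gmap, idx_pt hr, fract_pt hr]

lemma gmap_mem {n : ℕ} (p : Equiv.Perm (Fin (2 ^ n))) (u : ℝ) : gmap n p u ∈ Set.Ico (0 : ℝ) 1 :=
  pt_mem (fract_mem _)

lemma measurable_gmap (n : ℕ) (p : Equiv.Perm (Fin (2 ^ n))) : Measurable (gmap n p) := by
  have h1 : Measurable fun q : Fin (2 ^ n) × ℝ => pt n (p q.1) q.2 :=
    measurable_from_prod_countable_right fun q => measurable_pt n (p q)
  have h2 : Measurable fun u : ℝ => Int.fract (2 ^ n * u) := measurable_fract.comp (measurable_const_mul _)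
  have h3 : Measurable fun u : ℝ => (idx n u, Int.fract ((2 : ℝ) ^ n * u)) :=
    (measurable_idx n).prodMk h2
  have h4 := h1.comp h3
  have e : gmap n p = (fun q : Fin (2 ^ n) × ℝ => pt n (p q.1) q.2) ∘
    fun u : ℝ => (idx n u, Int.fract ((2 : ℝ) ^ n * u)) := by
    funext u; simp only [Function.comp, gmap]
  rw [e]; exact h4

lemma lint_idx (n : ℕ) (φ : Fin (2 ^ n) → ENNReal) :
    ∫⁻ u, φ (idx n u) ∂lam = ∑ m, ENNReal.ofReal (1 / 2 ^ n) * φ m := by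
  rw [selfsim n]
  refine Finset.sum_congr rfl fun m _ => ?_
  congr 1
  rw [lintegral_congr_Ico (g := fun _ => φ m) fun r hr => by simp only [idx_pt hr]]
  simp

lemma lam_idx (n : ℕ) (i : Fin (2 ^ n)) : lam (idx n ⁻¹' {i}) = ENNReal.ofReal (1 / 2 ^ n) := by
  classical
  rw [← lintegral_indicator_one (measurable_idx n (measurableSet_singleton i))]
  have := lint_idx n (Set.indicator {i} 1)
  rw [show (fun u => (idx n ⁻¹' {i}).indicator (1 : ℝ → ENNReal) u) =
    fun u => Set.indicator {i} (1 : Fin (2 ^ n) → ENNReal) (idx n u) from rfl, this]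
  rw [Finset.sum_eq_single i]
  · simp
  · intro j _ hj; simp [hj]
  · simp

lemma birkhoff (n : ℕ) (C : Fin (2 ^ n) → Fin (2 ^ n) → ℝ) (hC : ∀ i j, 0 ≤ C i j) :
    ∃ p : Equiv.Perm (Fin (2 ^ n)), ∀ γ : Measure (ℝ × ℝ), γ.map Prod.fst = lam →
      γ.map Prod.snd = lam →
      ∫⁻ u, ENNReal.ofReal (C (idx n u) (idx n (gmap n p u))) ∂lam ≤
        ∫⁻ q, ENNReal.ofReal (C (idx n q.1) (idx n q.2)) ∂γ := by
  obtain ⟨p, hp⟩ := Finite.exists_min fun p : Equiv.Perm (Fin (2 ^ n)) => ∑ i, C i (p i)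
  refine ⟨p, fun γ h1 h2 => ?_⟩
  have hpow : (0 : ℝ) < 2 ^ n := by positivity
  have hγp : IsProbabilityMeasure γ := by
    constructor
    have : γ.map Prod.fst Set.univ = 1 := by rw [h1]; exact measure_univ
    rwa [Measure.map_apply measurable_fst MeasurableSet.univ, Set.preimage_univ] at this
  have hlhs : ∫⁻ u, ENNReal.ofReal (C (idx n u) (idx n (gmap n p u))) ∂lam =
      ENNReal.ofReal (1 / 2 ^ n * ∑ i, C i (p i)) := by
    have e : ∀ u, idx n (gmap n p u) = p (idx n u) := fun u => idx_pt (fract_mem _)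
    simp only [e]
    rw [lint_idx n fun i => ENNReal.ofReal (C i (p i)), ← Finset.mul_sum,
      ← ENNReal.ofReal_sum_of_nonneg fun i _ => hC i (p i), ← ENNReal.ofReal_mul (by positivity)]
  have hmm : Measurable fun q : ℝ × ℝ => (idx n q.1, idx n q.2) :=
    ((measurable_idx n).comp measurable_fst).prodMk ((measurable_idx n).comp measurable_snd)
  set θ := γ.map fun q : ℝ × ℝ => (idx n q.1, idx n q.2) with hθ
  have hθp : IsProbabilityMeasure θ := Measure.isProbabilityMeasure_map hmm.aemeasurable
  have hθ1 : ∀ i, θ (Prod.fst ⁻¹' {i}) = ENNReal.ofReal (1 / 2 ^ n) := by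
    intro i
    rw [hθ, Measure.map_apply hmm (measurable_fst (measurableSet_singleton i)), ← lam_idx n i, ← h1,
      Measure.map_apply measurable_fst (measurable_idx n (measurableSet_singleton i))]
    rfl
  have hθ2 : ∀ i, θ (Prod.snd ⁻¹' {i}) = ENNReal.ofReal (1 / 2 ^ n) := by
    intro i
    rw [hθ, Measure.map_apply hmm (measurable_snd (measurableSet_singleton i)), ← lam_idx n i, ← h2,
      Measure.map_apply measurable_snd (measurable_idx n (measurableSet_singleton i))]
    rfl
  set M : Matrix (Fin (2 ^ n)) (Fin (2 ^ n)) ℝ := fun i j => 2 ^ n * θ.real {(i, j)} with hM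
  have hreal : ∀ A : Set (Fin (2 ^ n) × Fin (2 ^ n)), θ A = ENNReal.ofReal (1 / 2 ^ n) →
      2 ^ n * θ.real A = 1 := by
    intro A hA
    rw [Measure.real, hA, ENNReal.toReal_ofReal (by positivity)]; field_simp
  have hMd : M ∈ doublyStochastic ℝ (Fin (2 ^ n)) := by
    rw [mem_doublyStochastic_iff_sum]
    refine ⟨fun i j => by positivity, fun i => ?_, fun j => ?_⟩
    · rw [← hreal _ (hθ1 i)]
      simp only [hM]
      rw [← Finset.mul_sum]
      congr 1
      have : (Prod.fst ⁻¹' {i} : Set (Fin (2 ^ n) × Fin (2 ^ n))) = ⋃ j ∈ Finset.univ, {(i, j)} := by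
        ext ⟨x, y⟩; simp [eq_comm]
      rw [this, measureReal_biUnion_finset]
      · intro j _ k _ hjk; simp [Function.onFun, hjk]
      · intro j _; exact measurableSet_singleton _
    · rw [← hreal _ (hθ2 j)]
      simp only [hM]
      rw [← Finset.mul_sum]
      congr 1
      have : (Prod.snd ⁻¹' {j} : Set (Fin (2 ^ n) × Fin (2 ^ n))) = ⋃ i ∈ Finset.univ, {(i, j)} := by
        ext ⟨x, y⟩; simp [eq_comm]
      rw [this, measureReal_biUnion_finset]
      · intro i _ k _ hjk; simp [Function.onFun, hjk]
      · intro i _; exact measurableSet_singleton _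
  obtain ⟨w, hw0, hw1, hwM⟩ := exists_eq_sum_perm_of_mem_doublyStochastic hMd
  have hrhs : ∫⁻ q, ENNReal.ofReal (C (idx n q.1) (idx n q.2)) ∂γ =
      ENNReal.ofReal (1 / 2 ^ n * ∑ i, ∑ j, C i j * M i j) := by
    have e1 : ∫⁻ q, ENNReal.ofReal (C (idx n q.1) (idx n q.2)) ∂γ =
        ∫⁻ z, ENNReal.ofReal (C z.1 z.2) ∂θ := by
      rw [hθ, lintegral_map (Measurable.of_discrete) hmm]
    rw [e1, lintegral_fintype, Fintype.sum_prod_type, Finset.mul_sum, ENNReal.ofReal_sum_of_nonneg]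
    · refine Finset.sum_congr rfl fun i _ => ?_
      rw [Finset.mul_sum, ENNReal.ofReal_sum_of_nonneg]
      · refine Finset.sum_congr rfl fun j _ => ?_
        have : 1 / 2 ^ n * (C i j * M i j) = C i j * θ.real {(i, j)} := by
          simp only [hM]; field_simp
        rw [this, ENNReal.ofReal_mul (hC i j), Measure.real, ENNReal.ofReal_toReal (measure_ne_top _ _)]
      · intro j _; have := hC i j; simp only [hM]; positivity
    · intro i _
      refine mul_nonneg (by positivity) (Finset.sum_nonneg fun j _ => ?_)
      have := hC i j; simp only [hM]; positivity
  rw [hlhs, hrhs]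
  refine ENNReal.ofReal_le_ofReal (mul_le_mul_of_nonneg_left ?_ (by positivity))
  have hperm : ∀ (τ : Equiv.Perm (Fin (2 ^ n))) i, ∑ j, C i j * τ.permMatrix ℝ i j = C i (τ i) := by
    intro τ i
    rw [Finset.sum_eq_single (τ i)]
    · simp [Equiv.Perm.permMatrix, PEquiv.toMatrix_apply]
    · intro j _ hj
      simp [Equiv.Perm.permMatrix, PEquiv.toMatrix_apply, hj.symm]
    · simp
  calc ∑ i, C i (p i) = ∑ τ, w τ * ∑ i, C i (p i) := by rw [← Finset.sum_mul, hw1, one_mul]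
    _ ≤ ∑ τ, w τ * ∑ i, C i (τ i) := Finset.sum_le_sum fun τ _ =>
        mul_le_mul_of_nonneg_left (hp τ) (hw0 τ)
    _ = ∑ τ, ∑ i, ∑ j, C i j * (w τ * τ.permMatrix ℝ i j) := by
        refine Finset.sum_congr rfl fun τ _ => ?_
        rw [Finset.mul_sum]
        refine Finset.sum_congr rfl fun i _ => ?_
        rw [← hperm τ i, Finset.mul_sum]
        refine Finset.sum_congr rfl fun j _ => by ring
    _ = ∑ i, ∑ j, C i j * M i j := by
        rw [Finset.sum_comm]
        refine Finset.sum_congr rfl fun i _ => ?_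
        rw [Finset.sum_comm]
        refine Finset.sum_congr rfl fun j _ => ?_
        rw [← hwM, Matrix.sum_apply, Finset.mul_sum]
        rfl

end AMT
namespace AMT

lemma exists_split (n d : ℕ) : ∃ e : Fin (2 ^ n) × Fin (2 ^ d) ≃ Fin (2 ^ (n + d)),
    ∀ i j r, pt (n + d) (e (i, j)) r = pt n i (pt d j r) := by
  refine ⟨finProdFinEquiv.trans (finCongr (pow_add 2 n d).symm), fun i j r => ?_⟩
  simp only [pt, Equiv.trans_apply, finCongr_apply, Fin.val_cast, finProdFinEquiv_apply_val]
  push_cast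
  rw [pow_add]
  field_simp
  ring

lemma exists_adapt (n : ℕ) (p : Equiv.Perm (Fin (2 ^ n))) (N : ℕ) (h : n ≤ N) :
    ∃ p' : Equiv.Perm (Fin (2 ^ N)), ∀ m, ∀ r ∈ Set.Ico (0 : ℝ) 1,
      gmap n p (pt N m r) = pt N (p' m) r := by
  obtain ⟨d, rfl⟩ := Nat.exists_eq_add_of_le h
  obtain ⟨e, he⟩ := exists_split n d
  refine ⟨(e.symm.trans (p.prodCongr (Equiv.refl _))).trans e, fun m r hr => ?_⟩
  obtain ⟨⟨i, j⟩, rfl⟩ := e.surjective m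
  rw [he, gmap_pt p (pt_mem hr)]
  simp [he]

lemma idx_coarse (n N : ℕ) (h : n ≤ N) (m : Fin (2 ^ N)) (r : ℝ) (hr : r ∈ Set.Ico (0 : ℝ) 1) :
    idx n (pt N m r) = idx n (pt N m 0) := by
  obtain ⟨d, rfl⟩ := Nat.exists_eq_add_of_le h
  obtain ⟨e, he⟩ := exists_split n d
  obtain ⟨⟨i, j⟩, rfl⟩ := e.surjective m
  rw [he, he, idx_pt (pt_mem hr), idx_pt (pt_mem ⟨le_rfl, one_pos⟩)]

abbrev Kp := Σ n : ℕ, Equiv.Perm (Fin (2 ^ n))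

instance : MeasurableSpace Kp := ⊤
instance : DiscreteMeasurableSpace Kp := ⟨fun _ => trivial⟩
instance : Inhabited Kp := ⟨⟨0, 1⟩⟩

def gk (k : Kp) : ℝ → ℝ := gmap k.1 k.2

open Classical in
def adaptP (N : ℕ) (k : Kp) : Equiv.Perm (Fin (2 ^ N)) :=
  if h : k.1 ≤ N then (exists_adapt k.1 k.2 N h).choose else 1

lemma gk_pt {N : ℕ} {k : Kp} (h : k.1 ≤ N) (m : Fin (2 ^ N)) {r : ℝ} (hr : r ∈ Set.Ico (0 : ℝ) 1) :
    gk k (pt N m r) = pt N (adaptP N k m) r := by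
  rw [adaptP, dif_pos h]
  exact (exists_adapt k.1 k.2 N h).choose_spec m r hr

lemma measurable_gk_joint : Measurable fun q : Kp × ℝ => gk q.1 q.2 :=
  measurable_from_prod_countable_right fun q => measurable_gmap q.1 q.2

lemma map_G (N : ℕ) (G : ℝ → ℝ) (hGm : Measurable G) (J : ℝ → Kp) (hJ : Measurable J)
    (hlev : ∀ᵐ r ∂lam, (J r).1 ≤ N)
    (hG : ∀ m, ∀ r ∈ Set.Ico (0 : ℝ) 1, G (pt N m r) = gk (J r) (pt N m r)) :
    lam.map G = lam := by
  ext A hA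
  rw [Measure.map_apply hGm hA, ← lintegral_indicator_one (hGm hA), ← lintegral_indicator_one hA]
  exact lintegral_adapted N G (fun r => adaptP N (J r))
    (fun m => (Measurable.of_discrete (f := fun k => adaptP N k m)).comp hJ)
    (fun m => by
      filter_upwards [hlev, ae_lam_mem] with r h1 h2
      rw [hG m r h2, gk_pt h1 m h2])
    (A.indicator 1) (measurable_one.indicator hA)

lemma map_gk (k : Kp) : lam.map (gk k) = lam :=
  map_G k.1 (gk k) (measurable_gmap _ _) (fun _ => k) measurable_const (ae_of_all _ fun _ => le_rfl)
    fun _ _ _ => rfl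

lemma idx_gk (n N : ℕ) (hn : n ≤ N) {k : Kp} (h : k.1 ≤ N) (m : Fin (2 ^ N)) (r : ℝ)
    (hr : r ∈ Set.Ico (0 : ℝ) 1) : idx n (gk k (pt N m r)) = idx n (gk k (pt N m 0)) := by
  rw [gk_pt h m hr, gk_pt h m ⟨le_rfl, one_pos⟩, idx_coarse n N hn _ r hr]

lemma cost_gk (n N : ℕ) (hn : n ≤ N) {k : Kp} (h : k.1 ≤ N)
    (C : Fin (2 ^ n) → Fin (2 ^ n) → ENNReal) :
    ∫⁻ u, C (idx n u) (idx n (gk k u)) ∂lam =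
      ∑ m : Fin (2 ^ N), ENNReal.ofReal (1 / 2 ^ N) * C (idx n (pt N m 0)) (idx n (gk k (pt N m 0))) := by
  rw [selfsim N]
  refine Finset.sum_congr rfl fun m _ => ?_
  congr 1
  rw [lintegral_congr_Ico (g := fun _ => C (idx n (pt N m 0)) (idx n (gk k (pt N m 0)))) fun r hr => by
    simp only [idx_coarse n N hn m r hr, idx_gk n N hn h m r hr]]
  simp

lemma cost_G (n N : ℕ) (hn : n ≤ N) (C : Fin (2 ^ n) → Fin (2 ^ n) → ENNReal)
    (G : ℝ → ℝ) (J : ℝ → Kp) (hJ : Measurable J) (c : ENNReal)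
    (hlev : ∀ᵐ r ∂lam, (J r).1 ≤ N ∧ ∫⁻ u, C (idx n u) (idx n (gk (J r) u)) ∂lam ≤ c)
    (hG : ∀ m, ∀ r ∈ Set.Ico (0 : ℝ) 1, G (pt N m r) = gk (J r) (pt N m r)) :
    ∫⁻ u, C (idx n u) (idx n (G u)) ∂lam ≤ c := by
  rw [selfsim N]
  have h1 : ∀ m : Fin (2 ^ N), ∫⁻ r, C (idx n (pt N m r)) (idx n (G (pt N m r))) ∂lam =
      ∫⁻ r, C (idx n (pt N m 0)) (idx n (gk (J r) (pt N m 0))) ∂lam := by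
    intro m
    refine lintegral_congr_ae ?_
    filter_upwards [hlev, ae_lam_mem] with r h1 h2
    simp only [hG m r h2, idx_coarse n N hn m r h2, idx_gk n N hn h1.1 m r h2]
  simp only [h1]
  have hm : ∀ m : Fin (2 ^ N), Measurable fun r => ENNReal.ofReal (1 / 2 ^ N) *
      C (idx n (pt N m 0)) (idx n (gk (J r) (pt N m 0))) := fun m =>
    (Measurable.of_discrete (f := fun k : Kp => ENNReal.ofReal (1 / 2 ^ N) *
      C (idx n (pt N m 0)) (idx n (gk k (pt N m 0))))).comp hJ
  have h2 : ∀ m : Fin (2 ^ N), ENNReal.ofReal (1 / 2 ^ N) *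
      ∫⁻ r, C (idx n (pt N m 0)) (idx n (gk (J r) (pt N m 0))) ∂lam =
      ∫⁻ r, ENNReal.ofReal (1 / 2 ^ N) * C (idx n (pt N m 0)) (idx n (gk (J r) (pt N m 0))) ∂lam :=
    fun m => (lintegral_const_mul' _ _ (by simp)).symm
  simp only [h2]
  rw [← lintegral_finsetSum _ fun m _ => hm m]
  calc _ ≤ ∫⁻ _r, c ∂lam := by
        refine lintegral_mono_ae ?_
        filter_upwards [hlev] with r hr
        have := cost_gk n N hn hr.1 C
        rw [← this]; exact hr.2
    _ = c := by simp

end AMT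
namespace AMT

def AppC (c : ℝ → ℝ → ENNReal) (n : ℕ) (C : Fin (2 ^ n) → Fin (2 ^ n) → ENNReal) (e : ENNReal) : Prop :=
  ∃ α β : ℝ → ENNReal, Measurable α ∧ Measurable β ∧
    ∫⁻ u, α u ∂lam + ∫⁻ v, β v ∂lam ≤ e ∧
    ∀ u v, c u v ≤ C (idx n u) (idx n v) + (α u + β v) ∧
      C (idx n u) (idx n v) ≤ c u v + (α u + β v)

lemma AppC.int {α β : ℝ → ENNReal} (hα : Measurable α) (hβ : Measurable β) {e : ENNReal}
    (he : ∫⁻ u, α u ∂lam + ∫⁻ v, β v ∂lam ≤ e) (G : ℝ → ℝ) (hG : Measurable G)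
    (hGl : lam.map G = lam) (f : ℝ → ENNReal) :
    ∫⁻ u, (f u + (α u + β (G u))) ∂lam ≤ ∫⁻ u, f u ∂lam + e := by
  have hm : Measurable fun u => α u + β (G u) := hα.add (hβ.comp hG)
  rw [lintegral_add_right _ hm, lintegral_add_left hα]
  have : ∫⁻ u, β (G u) ∂lam = ∫⁻ v, β v ∂lam := by
    conv_rhs => rw [← hGl]
    rw [lintegral_map hβ hG]
  rw [this]; gcongr

lemma AppC.le1 {c : ℝ → ℝ → ENNReal} {n : ℕ} {C : Fin (2 ^ n) → Fin (2 ^ n) → ENNReal} {e : ENNReal}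
    (h : AppC c n C e) (G : ℝ → ℝ) (hG : Measurable G) (hGl : lam.map G = lam) :
    ∫⁻ u, c u (G u) ∂lam ≤ ∫⁻ u, C (idx n u) (idx n (G u)) ∂lam + e := by
  obtain ⟨α, β, hα, hβ, he, H⟩ := h
  exact (lintegral_mono fun u => (H u (G u)).1).trans (AppC.int hα hβ he G hG hGl _)

lemma AppC.le2 {c : ℝ → ℝ → ENNReal} {n : ℕ} {C : Fin (2 ^ n) → Fin (2 ^ n) → ENNReal} {e : ENNReal}
    (h : AppC c n C e) (G : ℝ → ℝ) (hG : Measurable G) (hGl : lam.map G = lam) :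
    ∫⁻ u, C (idx n u) (idx n (G u)) ∂lam ≤ ∫⁻ u, c u (G u) ∂lam + e := by
  obtain ⟨α, β, hα, hβ, he, H⟩ := h
  exact (lintegral_mono fun u => (H u (G u)).2).trans (AppC.int hα hβ he G hG hGl _)

lemma ae_pt (N : ℕ) {p : ℝ → Prop} : (∀ᵐ u ∂lam, p u) ↔ ∀ m, ∀ᵐ r ∂lam, p (pt N m r) := by
  have key : ∀ A : Set ℝ, MeasurableSet A → (lam A = 0 ↔ ∀ m : Fin (2 ^ N), lam (pt N m ⁻¹' A) = 0) := by
    intro A hA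
    rw [← lintegral_indicator_one hA, selfsim N, Finset.sum_eq_zero_iff]
    refine forall_congr' fun m => ?_
    rw [← lintegral_indicator_one (measurable_pt N m hA)]
    simp only [Finset.mem_univ, true_imp_iff, mul_eq_zero]
    constructor
    · rintro (h | h)
      · rw [ENNReal.ofReal_eq_zero] at h
        exact absurd h (not_le.2 (by positivity))
      · exact h
    · exact fun h => Or.inr h
  constructor
  · intro h m
    have h1 : lam (toMeasurable lam {u | ¬ p u}) = 0 := by rw [measure_toMeasurable]; exact h
    have h2 := (key _ (measurableSet_toMeasurable _ _)).1 h1 m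
    refine measure_mono_null (fun r hr => ?_) h2
    have h3 : ¬ p (pt N m r) := by simpa using hr
    have h4 : pt N m r ∈ toMeasurable lam {u | ¬ p u} := subset_toMeasurable lam {u | ¬ p u} (by simpa using h3)
    simpa using h4
  · intro h
    have h1 : ∀ m : Fin (2 ^ N), lam (pt N m '' (Set.Ico 0 1 ∩ {r | ¬ p (pt N m r)})) = 0 := by
      intro m
      have h2 : volume (Set.Ico 0 1 ∩ {r | ¬ p (pt N m r)}) = 0 := by
        have := h m
        rw [ae_iff, lam, Measure.restrict_apply' measurableSet_Ico] at this
        rwa [Set.inter_comm]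
      have h3 : volume (pt N m '' (Set.Ico 0 1 ∩ {r | ¬ p (pt N m r)})) = 0 :=
        addHaar_image_eq_zero_of_differentiableOn_of_addHaar_eq_zero volume
          (by unfold pt; fun_prop) h2
      exact Measure.restrict_le_self.absolutelyContinuous h3
    rw [ae_iff]
    refine measure_mono_null ?_ (measure_union_null (measure_iUnion_null h1)
      (show lam (Set.Ico (0 : ℝ) 1)ᶜ = 0 from ae_lam_mem))
    intro u hu
    by_cases hI : u ∈ Set.Ico (0 : ℝ) 1
    · left
      refine Set.mem_iUnion.2 ⟨idx N u, ?_⟩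
      refine ⟨Int.fract (2 ^ N * u), ⟨fract_mem _, ?_⟩, pt_idx hI⟩
      show ¬ p _
      rw [pt_idx hI]; exact hu
    · right; exact hI

lemma ae_affine {p : ℝ → Prop} (h : ∀ᵐ v ∂lam, p v) (A B : ℝ) (hB : 0 < B)
    (hAB : ∀ r ∈ Set.Ico (0 : ℝ) 1, A + B * r ∈ Set.Ico (0 : ℝ) 1) : ∀ᵐ r ∂lam, p (A + B * r) := by
  have h1 : ∀ᵐ v ∂(volume : Measure ℝ), v ∈ Set.Ico (0 : ℝ) 1 → p v :=
    (ae_restrict_iff' measurableSet_Ico).1 h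
  have h2 : ∀ᵐ r ∂(volume : Measure ℝ), A + B * r ∈ Set.Ico (0 : ℝ) 1 → p (A + B * r) := by
    rw [ae_iff] at h1 ⊢
    have e : {r | ¬(A + B * r ∈ Set.Ico (0 : ℝ) 1 → p (A + B * r))} =
        (B * ·) ⁻¹' ((A + ·) ⁻¹' {v | ¬(v ∈ Set.Ico (0 : ℝ) 1 → p v)}) := rfl
    rw [e, Real.volume_preimage_mul_left hB.ne', measure_preimage_add, h1, mul_zero]
  refine (ae_restrict_iff' measurableSet_Ico).2 ?_
  filter_upwards [h2] with r hr hrI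
  exact hr (hAB r hrI)

lemma fract_fine (N M : ℕ) (h : N ≤ M) (m : Fin (2 ^ M)) {r : ℝ} (hr : r ∈ Set.Ico (0 : ℝ) 1) :
    Int.fract (2 ^ N * pt M m r) = Int.fract (2 ^ N * pt M m 0) + (2 ^ N / 2 ^ M) * r := by
  obtain ⟨d, rfl⟩ := Nat.exists_eq_add_of_le h
  obtain ⟨e, he⟩ := exists_split N d
  obtain ⟨⟨i, j⟩, rfl⟩ := e.surjective m
  rw [he, he, fract_pt (pt_mem hr), fract_pt (pt_mem ⟨le_rfl, one_pos⟩)]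
  unfold pt
  rw [pow_add]; field_simp; ring

lemma fract_coarse (N M : ℕ) (h : M ≤ N) (m : Fin (2 ^ M)) (r : ℝ) :
    Int.fract (2 ^ N * pt M m r) = Int.fract (2 ^ N * (r / 2 ^ M)) := by
  obtain ⟨d, rfl⟩ := Nat.exists_eq_add_of_le h
  have : (2 : ℝ) ^ (M + d) * pt M m r = 2 ^ (M + d) * (r / 2 ^ M) + ((2 ^ d * (m : ℕ) : ℕ) : ℝ) := by
    unfold pt; rw [pow_add]; push_cast; field_simp; ring
  rw [this, Int.fract_add_natCast]

section pou
variable {ι T : Type*} [TopologicalSpace T] (φ : PartitionOfUnity ι T Set.univ)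

def pw (t : T) : List ι → ℝ
  | [] => 1
  | i :: s => φ i t * pw t s

lemma pou_hasSum (t : T) : HasSum (fun i => φ i t) 1 := by
  have h := φ.sum_eq_one (Set.mem_univ t)
  have hf : (Function.support fun i => φ i t).Finite := φ.locallyFinite.point_finite t
  have hsm : Summable (fun i => φ i t) := summable_of_finite_support hf
  have h3 := hsm.hasSum
  rwa [tsum_eq_finsum hf, h] at h3

lemma pw_nonneg (t : T) (s : List ι) : 0 ≤ pw φ t s := by
  induction s with
  | nil => exact zero_le_one
  | cons i s ih => exact mul_nonneg (φ.nonneg i t) ih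

lemma pw_tree (t : T) : WTree (pw φ t) where
  nonneg := pw_nonneg φ t
  root := rfl
  sum s := by simpa [pw] using (pou_hasSum φ t).mul_right (pw φ t s)

lemma pw_cont (s : List ι) : Continuous fun t => pw φ t s := by
  induction s with
  | nil => exact continuous_const
  | cons i s ih => exact (φ i).continuous.mul ih

end pou

section rho
variable {T : Type*} [TopologicalSpace T] (χ : PartitionOfUnity ℕ T Set.univ)

def rho (t : T) (u : ℝ) : ℝ := ∑ᶠ N, χ N t • Int.fract (2 ^ N * u)

def act (t : T) : Finset ℕ := (χ.locallyFinite.point_finite t).toFinset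

lemma mem_act (t : T) (N : ℕ) : N ∈ act χ t ↔ χ N t ≠ 0 := by
  unfold act
  rw [Set.Finite.mem_toFinset]
  exact Iff.rfl

lemma rho_eq (t : T) (u : ℝ) : rho χ t u = ∑ N ∈ act χ t, χ N t * Int.fract (2 ^ N * u) := by
  unfold rho
  simp only [smul_eq_mul]
  refine finsum_eq_sum_of_support_subset _ fun N hN => ?_
  rw [Finset.mem_coe, mem_act]
  exact left_ne_zero_of_mul hN

lemma act_sum (t : T) : ∑ N ∈ act χ t, χ N t = 1 := by
  rw [← χ.sum_eq_one (Set.mem_univ t)]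
  refine (finsum_eq_sum_of_support_subset _ fun N hN => ?_).symm
  rw [Finset.mem_coe, mem_act]
  exact hN

lemma act_nonempty (t : T) : (act χ t).Nonempty := by
  by_contra h
  rw [Finset.not_nonempty_iff_eq_empty] at h
  have := act_sum χ t
  rw [h] at this; simp at this

lemma act_pos {t : T} {N : ℕ} (h : N ∈ act χ t) : 0 < χ N t :=
  lt_of_le_of_ne (χ.nonneg N t) ((mem_act χ t N).1 h).symm

lemma rho_cont (u : ℝ) : Continuous fun t => rho χ t u :=
  χ.continuous_finsum_smul fun _ _ _ => continuousAt_const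

lemma rho_meas (t : T) : Measurable (rho χ t) := by
  have : rho χ t = fun u => ∑ N ∈ act χ t, χ N t * Int.fract (2 ^ N * u) := funext (rho_eq χ t)
  rw [this]
  refine Finset.measurable_fun_sum _ fun N _ => ?_
  exact (measurable_fract.comp (measurable_const_mul _)).const_mul _

lemma rho_mem (t : T) (u : ℝ) : rho χ t u ∈ Set.Ico (0 : ℝ) 1 := by
  rw [rho_eq]
  constructor
  · exact Finset.sum_nonneg fun N _ => mul_nonneg (χ.nonneg N t) (Int.fract_nonneg _)
  · rw [← act_sum χ t]
    refine Finset.sum_lt_sum_of_nonempty (act_nonempty χ t) fun N hN => ?_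
    exact mul_lt_of_lt_one_right (act_pos χ hN) (Int.fract_lt_one _)

lemma rho_coarse (t : T) (M : ℕ) (hM : ∀ N ∈ act χ t, M ≤ N) (m : Fin (2 ^ M)) (r : ℝ) :
    rho χ t (pt M m r) = rho χ t (r / 2 ^ M) := by
  rw [rho_eq, rho_eq]
  refine Finset.sum_congr rfl fun N hN => ?_
  rw [fract_coarse N M (hM N hN)]

lemma rho_ae (t : T) {p : ℝ → Prop} (hp : ∀ᵐ v ∂lam, p v) : ∀ᵐ u ∂lam, p (rho χ t u) := by
  set M := (act χ t).sup id with hM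
  rw [ae_pt M]
  intro m
  have e : ∀ r ∈ Set.Ico (0 : ℝ) 1, rho χ t (pt M m r) =
      rho χ t (pt M m 0) + (∑ N ∈ act χ t, χ N t * (2 ^ N / 2 ^ M)) * r := by
    intro r hr
    rw [rho_eq, rho_eq, Finset.sum_mul, ← Finset.sum_add_distrib]
    refine Finset.sum_congr rfl fun N hN => ?_
    rw [fract_fine N M (Finset.le_sup (f := id) hN) m hr]; ring
  have hB : 0 < ∑ N ∈ act χ t, χ N t * ((2 : ℝ) ^ N / 2 ^ M) :=
    Finset.sum_pos (fun N hN => mul_pos (act_pos χ hN) (by positivity)) (act_nonempty χ t)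
  have := ae_affine hp (rho χ t (pt M m 0)) _ hB fun r hr => by
    rw [← e r hr]; exact rho_mem χ t _
  filter_upwards [this, ae_lam_mem] with r h1 h2
  rw [e r h2]; exact h1

end rho

theorem assembly {T : Type*} [MetricSpace T] (c : T → ℝ → ℝ → ENNReal) (Kc : T → ENNReal)
    (e : ENNReal)
    (H : ∀ t₀, ∃ (n : ℕ) (C : Fin (2 ^ n) → Fin (2 ^ n) → ENNReal) (k : Kp), ∀ᶠ t in 𝓝 t₀,
      AppC (c t) n C e ∧ ∫⁻ u, C (idx n u) (idx n (gk k u)) ∂lam ≤ Kc t + e) :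
    ∃ G : T → ℝ → ℝ, (∀ t, Measurable (G t)) ∧ (∀ t, lam.map (G t) = lam) ∧
      (∀ t, ∫⁻ u, c t u (G t u) ∂lam ≤ Kc t + (e + e + e + e)) ∧
      ∀ (t : T) (tn : ℕ → T), Tendsto tn atTop (𝓝 t) → ∀ᵐ u ∂lam, ∀ᶠ n in atTop, G (tn n) u = G t u := by
  have hgm : ∀ k, Measurable (gk k) := fun k => measurable_gmap _ _
  set O : Kp → Set T := fun k => interior {t | ∫⁻ u, c t u (gk k u) ∂lam ≤ Kc t + (e + e)} with hO
  have hOc : Set.univ ⊆ ⋃ k, O k := by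
    intro t₀ _
    obtain ⟨n, C, k, hk⟩ := H t₀
    refine Set.mem_iUnion.2 ⟨k, mem_interior_iff_mem_nhds.2 ?_⟩
    filter_upwards [hk] with t ht
    refine (ht.1.le1 (gk k) (hgm k) (map_gk k)).trans ?_
    rw [← add_assoc]; gcongr; exact ht.2
  obtain ⟨φ, hφ⟩ := PartitionOfUnity.exists_isSubordinate isClosed_univ O
    (fun k => isOpen_interior) hOc
  have hφO : ∀ k t, φ k t ≠ 0 → ∫⁻ u, c t u (gk k u) ∂lam ≤ Kc t + (e + e) := by
    intro k t hkt
    have h1 : t ∈ O k := hφ k (subset_tsupport _ hkt)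
    have h2 := interior_subset h1
    simpa only [Set.mem_setOf_eq] using h2
  set V : ℕ → Set T := fun N => interior {t | (∀ k, φ k t ≠ 0 → k.1 ≤ N) ∧
    ∃ n ≤ N, ∃ C, AppC (c t) n C e} with hV
  have hVc : Set.univ ⊆ ⋃ N, V N := by
    intro t₀ _
    obtain ⟨n, C, k, hk⟩ := H t₀
    obtain ⟨U, hU, hUf⟩ := φ.locallyFinite t₀
    refine Set.mem_iUnion.2 ⟨max n (hUf.toFinset.sup Sigma.fst), mem_interior_iff_mem_nhds.2 ?_⟩
    filter_upwards [hk, hU] with t ht htU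
    refine ⟨fun k hkt => ?_, n, le_max_left _ _, C, ht.1⟩
    refine le_trans ?_ (le_max_right _ _)
    refine Finset.le_sup (f := Sigma.fst) ?_
    rw [Set.Finite.mem_toFinset]
    exact ⟨t, hkt, htU⟩
  obtain ⟨χ, hχ⟩ := PartitionOfUnity.exists_isSubordinate isClosed_univ V
    (fun k => isOpen_interior) hVc
  have hχV : ∀ N t, N ∈ act χ t → (∀ k, φ k t ≠ 0 → k.1 ≤ N) ∧ ∃ n ≤ N, ∃ C, AppC (c t) n C e := by
    intro N t hkt
    have h1 : t ∈ V N := hχ N (subset_tsupport _ ((mem_act χ t N).1 hkt))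
    have h2 := interior_subset h1
    simpa only [Set.mem_setOf_eq] using h2
  have hsel : ∀ t, Measurable (sel (pw φ t) 0) := fun t => sel_measurable (pw_tree φ t) 0
  have hselk : ∀ t k v, v ∈ ocell (pw φ t) [k] → sel (pw φ t) 0 v = k := fun t k v hv =>
    sel_eq (pw_tree φ t) (s := []) (ocell_sub _ hv)
  have hae : ∀ t, ∀ᵐ u ∂lam, ∃ k, rho χ t u ∈ ocell (pw φ t) [k] := by
    intro t
    refine rho_ae χ t (p := fun v => ∃ k, v ∈ ocell (pw φ t) [k]) ?_
    filter_upwards [ae_good (pw_tree φ t) 1] with v hv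
    obtain ⟨s, hs, hvs⟩ := hv
    obtain ⟨k, rfl⟩ := List.length_eq_one_iff.1 hs
    exact ⟨k, hvs⟩
  have hactive : ∀ t k v, v ∈ ocell (pw φ t) [k] → φ k t ≠ 0 := by
    intro t k v hv
    have := pos_of_mem_cell (ocell_sub _ hv)
    simp only [pw, mul_one] at this
    exact this.ne'
  set G : T → ℝ → ℝ := fun t u => gk (sel (pw φ t) 0 (rho χ t u)) u with hGdef
  have hGm : ∀ t, Measurable (G t) := by
    intro t
    have h3 : Measurable fun u : ℝ => (sel (pw φ t) 0 (rho χ t u), u) :=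
      ((hsel t).comp (rho_meas χ t)).prodMk measurable_id
    have h4 := measurable_gk_joint.comp h3
    exact h4
  have hmain : ∀ t, ∃ N ∈ act χ t, ∃ J : ℝ → Kp, Measurable J ∧ (∀ᵐ r ∂lam, φ (J r) t ≠ 0) ∧
      ∀ m, ∀ r ∈ Set.Ico (0 : ℝ) 1, G t (pt N m r) = gk (J r) (pt N m r) := by
    intro t
    set N := (act χ t).min' (act_nonempty χ t) with hN
    have hmin : ∀ M ∈ act χ t, N ≤ M := fun M hM => Finset.min'_le _ _ hM
    refine ⟨N, Finset.min'_mem _ _, fun r => sel (pw φ t) 0 (rho χ t (r / 2 ^ N)), ?_, ?_, ?_⟩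
    · exact (hsel t).comp ((rho_meas χ t).comp (measurable_id.div_const _))
    · have h1 := (ae_pt N).1 (hae t) ⟨0, by positivity⟩
      filter_upwards [h1] with r hr
      obtain ⟨k, hk⟩ := hr
      rw [rho_coarse χ t N hmin] at hk
      rw [hselk t k _ hk]
      exact hactive t k _ hk
    · intro m r _
      simp only [hGdef, rho_coarse χ t N hmin]
  have hGl : ∀ t, lam.map (G t) = lam := by
    intro t
    obtain ⟨N, hN, J, hJ, hJa, hGJ⟩ := hmain t
    refine map_G N (G t) (hGm t) J hJ ?_ hGJ
    filter_upwards [hJa] with r hr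
    exact (hχV N t hN).1 _ hr
  refine ⟨G, hGm, hGl, fun t => ?_, fun t tn htn => ?_⟩
  · obtain ⟨N, hN, J, hJ, hJa, hGJ⟩ := hmain t
    obtain ⟨hlev, n, hnN, C, hC⟩ := hχV N t hN
    refine (hC.le1 (G t) (hGm t) (hGl t)).trans ?_
    have := cost_G n N hnN C (G t) J hJ (Kc t + (e + e + e)) (by
      filter_upwards [hJa] with r hr
      refine ⟨hlev _ hr, ?_⟩
      refine (hC.le2 (gk (J r)) (hgm _) (map_gk _)).trans ?_
      rw [← add_assoc (Kc t)]
      gcongr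
      exact hφO _ t hr) hGJ
    rw [← add_assoc (Kc t)]
    gcongr
  · filter_upwards [hae t] with u hu
    obtain ⟨k, hk⟩ := hu
    have h1 : Tendsto (fun n => rho χ (tn n) u) atTop (𝓝 (rho χ t u)) :=
      ((rho_cont χ u).tendsto t).comp htn
    filter_upwards [ocell_open (pw φ) (pw_tree φ) (pw_cont φ) [k] htn h1 hk] with n hn
    simp only [hGdef]
    rw [hselk t k _ hk, hselk (tn n) k _ hn]

end AMT

/-- **Theorem 3 of the paper.** `X`, `Y` complete metric spaces, `μ` a fixed
non-atomic Radon probability measure on `X`, `t ↦ ν t` a weakly continuous family of Radon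
probability measures on `Y`, `h` a continuous nonnegative cost satisfying the uniform
integrability bound. Then for every `ε > 0` one can select `ε`-optimal Monge mappings
`T_t` with `μ ∘ T_t⁻¹ = ν t`, continuous in `t` in the sense of convergence `μ`-a.e. -/
theorem approx_monge_varying_target
    {X Y T : Type*} [MetricSpace X] [CompleteSpace X] [MetricSpace Y] [CompleteSpace Y]
    [MetricSpace T] [MeasurableSpace X] [BorelSpace X] [MeasurableSpace Y] [BorelSpace Y]
    (μ : Measure X) (ν : T → Measure Y)
    (hμp : IsProbabilityMeasure μ) (hνp : ∀ t, IsProbabilityMeasure (ν t))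
    (hμna : NoAtoms μ) (hμr : μ.InnerRegular) (hνr : ∀ t, (ν t).InnerRegular)
    (hνc : WeaklyContinuousFamily ν)
    (h : X → Y → T → ℝ)
    (hcont : Continuous fun p : X × Y × T => h p.1 p.2.1 p.2.2)
    (hnonneg : ∀ x y t, 0 ≤ h x y t)
    (a : T → X → ℝ) (b : T → Y → ℝ)
    (hameas : ∀ t, Measurable (a t)) (hbmeas : ∀ t, Measurable (b t))
    (ha0 : ∀ t x, 0 ≤ a t x) (hb0 : ∀ t y, 0 ≤ b t y)
    (haint : ∀ t, Integrable (a t) μ) (hbint : ∀ t, Integrable (b t) (ν t))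
    (hdom : ∀ t x y, h x y t ≤ a t x + b t y)
    (hunif : ∀ ε > (0 : ℝ), ∃ R₀ : ℝ, ∀ R ≥ R₀, ∀ t : T,
      (∫ x in {x | R ≤ a t x}, a t x ∂μ) + ∫ y in {y | R ≤ b t y}, b t y ∂(ν t) ≤ ε)
    (ε : ℝ) (hε : 0 < ε) :
    ∃ Tm : T → X → Y,
      (∀ t, Measurable (Tm t)) ∧
      (∀ t, μ.map (Tm t) = ν t) ∧
      (∀ t, (∫⁻ x, ENNReal.ofReal (h x (Tm t x) t) ∂μ) ≤
        kantorovichCost (fun x y => h x y t) μ (ν t) + ENNReal.ofReal ε) ∧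
      (∀ (t : T) (tn : ℕ → T), Tendsto tn atTop (𝓝 t) →
        ∀ᵐ x ∂μ, Tendsto (fun n => Tm (tn n) x) atTop (𝓝 (Tm t x))) := by
  rcases isEmpty_or_nonempty T with hT | ⟨⟨t₁⟩⟩
  · exact ⟨fun t => isEmptyElim t, fun t => isEmptyElim t, fun t => isEmptyElim t,
      fun t => isEmptyElim t, fun t => isEmptyElim t⟩
  haveI : NullSingletonClass μ := hμna
  haveI : Nonempty X := μ.nonempty_of_neZero
  haveI : Nonempty Y := (ν t₁).nonempty_of_neZero
  obtain ⟨S, hS, hSν, hSc⟩ := AMT.skorokhod ν hνp hνr hνc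
  obtain ⟨P, Q, hP, hQ, hPμ, hQP⟩ := AMT.xside μ hμr
  have hQμ : AMT.lam.map Q = μ := by
    rw [← hPμ, Measure.map_map hQ hP]
    have h1 : Q ∘ P =ᵐ[μ] id := hQP
    rw [Measure.map_congr h1, Measure.map_id]
  have hct : ∀ t, Continuous fun p : X × Y => h p.1 p.2 t := fun t =>
    hcont.comp (continuous_fst.prodMk (continuous_snd.prodMk continuous_const))
  have hε4 : 0 < ε / 4 := by linarith
  obtain ⟨G, hGm, hGl, hGc, hGt⟩ := AMT.assembly
    (fun t u v => ENNReal.ofReal (h (Q u) (S t v) t))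
    (fun t => kantorovichCost (fun x y => h x y t) μ (ν t)) (ENNReal.ofReal (ε / 4)) (by
      intro t₀
      obtain ⟨n, C, hC, hev⟩ := AMT.mainN μ ν hμr hνr h hcont hnonneg a b hameas hbmeas ha0 hb0
        haint hbint hdom hunif Q hQ hQμ S hS hSν hSc t₀ (ε / 4) hε4
      obtain ⟨p, hp⟩ := AMT.birkhoff n C hC
      refine ⟨n, fun i j => ENNReal.ofReal (C i j), ⟨n, p⟩, ?_⟩
      filter_upwards [hev] with t ht
      refine ⟨ht, ?_⟩
      obtain ⟨α, β, hα, hβ, he, H⟩ := ht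
      refine tsub_le_iff_right.1 (le_iInf₂ fun σ hσ => tsub_le_iff_right.2 ?_)
      obtain ⟨γ, hγ1, hγ2, hγ⟩ := AMT.lift_coupling μ (ν t) hμr (hνr t) (fun x y => h x y t) (hct t)
        σ hσ.1 hσ.2 P hP hPμ Q hQP (S t) (hS t) (hSν t)
      refine (hp γ hγ1 hγ2).trans ?_
      refine (lintegral_mono fun q : ℝ × ℝ => (H q.1 q.2).2).trans ?_
      have hm1 : Measurable fun q : ℝ × ℝ => α q.1 := hα.comp measurable_fst
      have hm2 : Measurable fun q : ℝ × ℝ => β q.2 := hβ.comp measurable_snd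
      have hm3 : Measurable fun q : ℝ × ℝ => α q.1 + β q.2 := hm1.add hm2
      rw [lintegral_add_right _ hm3, lintegral_add_left hm1,
        ← lintegral_map hα measurable_fst, ← lintegral_map hβ measurable_snd, hγ1, hγ2]
      exact add_le_add hγ he)
  have hGP : ∀ t, μ.map (fun x => G t (P x)) = AMT.lam := by
    intro t
    have : (fun x => G t (P x)) = G t ∘ P := rfl
    rw [this, ← Measure.map_map (hGm t) hP, hPμ, hGl]
  have hGSm : ∀ t, Measurable fun u => S t (G t u) := fun t => (hS t).comp (hGm t)
  have hGS : ∀ t, AMT.lam.map (fun u => S t (G t u)) = ν t := by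
    intro t
    have : (fun u => S t (G t u)) = S t ∘ G t := rfl
    rw [this, ← Measure.map_map (hS t) (hGm t), hGl, hSν]
  refine ⟨fun t x => S t (G t (P x)), fun t => (hGSm t).comp hP, fun t => ?_, fun t => ?_, ?_⟩
  · have : (fun x => S t (G t (P x))) = S t ∘ fun x => G t (P x) := rfl
    show μ.map (fun x => S t (G t (P x))) = ν t
    have hm : Measurable fun x => G t (P x) := (hGm t).comp hP
    rw [this, ← Measure.map_map (hS t) hm, hGP, hSν]
  · have hpm : Measurable fun u => (Q u, S t (G t u)) := hQ.prodMk (hGSm t)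
    have haem := AMT.aemeas_cost μ (ν t) hμr (hνr t) (fun x y => h x y t) (hct t)
      (AMT.lam.map fun u => (Q u, S t (G t u)))
      (by rw [Measure.map_map measurable_fst hpm]; exact hQμ)
      (by rw [Measure.map_map measurable_snd hpm]; exact hGS t)
    have haem2 : AEMeasurable (fun u => ENNReal.ofReal (h (Q u) (S t (G t u)) t)) AMT.lam :=
      haem.comp_measurable hpm
    have h1 : ∫⁻ x, ENNReal.ofReal (h x (S t (G t (P x))) t) ∂μ =
        ∫⁻ u, ENNReal.ofReal (h (Q u) (S t (G t u)) t) ∂AMT.lam := by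
      rw [← hPμ] at haem2 ⊢
      rw [lintegral_map' haem2 hP.aemeasurable]
      refine lintegral_congr_ae ?_
      filter_upwards [hQP] with x hx
      rw [hx]
    rw [h1]
    refine (hGc t).trans (le_of_eq ?_)
    congr 1
    rw [← ENNReal.ofReal_add hε4.le hε4.le, ← ENNReal.ofReal_add (by linarith) hε4.le,
      ← ENNReal.ofReal_add (by linarith) hε4.le]
    congr 1; ring
  · intro t tn htn
    have h1 := hGt t tn htn
    rw [← hPμ] at h1
    have h1' := ae_of_ae_map hP.aemeasurable h1
    have h2 := hSc t tn htn
    rw [← hGP t] at h2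
    have h2' := ae_of_ae_map ((hGm t).comp hP).aemeasurable h2
    filter_upwards [h1', h2'] with x hx1 hx2
    refine hx2.congr' ?_
    filter_upwards [hx1] with n hn
    show S (tn n) (G t (P x)) = S (tn n) (G (tn n) (P x))
    rw [hn]
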